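/- arXiv:1604.08817 — 5 statements merged into one kernel-verified Lean document; each statement's English description precedes it below -/
import Mathlib

section
/- Fix an integer r ≥ 2. Then for all sufficiently large n, (1/(570r))·n/√(log n) ≤ NGΣ↓_η(r;n) ≤ r·n/√(log n), where log denotes logarithm base 2. In particular NGΣ↓_η(r;n) = Θ(n/√(log n)) as n → ∞. -/
open scoped Classical

namespace NG

/-- The set of earlier neighbors (back-neighborhood) of vertex `j` in `H`,
with respect to the natural order on `Fin N`. -/
noncomputable def backNbhd {N : ℕ} (H : SimpleGraph (Fin N)) (j : Fin N) :
    Finset (Fin N) :=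
  Finset.univ.filter (fun i => (i : ℕ) < (j : ℕ) ∧ H.Adj i j)

/-- The degree of `u` in the subgraph of `H` induced on the first `j` vertices
(the "stage `j`" graph of the construction). -/
noncomputable def stageDeg {N : ℕ} (H : SimpleGraph (Fin N)) (j : ℕ) (u : Fin N) : ℕ :=
  (Finset.univ.filter (fun w : Fin N => (w : ℕ) < j ∧ (u : ℕ) < j ∧ H.Adj u w)).card

/-- `H` on `Fin N` is a `k`-tree, built in the natural vertex order: the first
`k+1` vertices form a clique, and every later vertex is joined exactly to the
vertices of an existing `k`-clique. -/
def IsKTreeOrd (k : ℕ) (N : ℕ) (H : SimpleGraph (Fin N)) : Prop :=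
  1 ≤ k ∧ k + 1 ≤ N ∧
  (∀ i j : Fin N, (i : ℕ) < (j : ℕ) → (j : ℕ) ≤ k → H.Adj i j) ∧
  (∀ j : Fin N, k < (j : ℕ) →
    (backNbhd H j).card = k ∧ H.IsClique (backNbhd H j : Set (Fin N)))

/-- A linear `k`-tree: a `k`-tree in which each new vertex (after the first added
one) is joined to a `k`-clique containing the vertex added at the previous step. -/
def IsLinearKTreeOrd (k : ℕ) (N : ℕ) (H : SimpleGraph (Fin N)) : Prop :=
  IsKTreeOrd k N H ∧
  ∀ i j : Fin N, (i : ℕ) + 1 = (j : ℕ) → k + 1 < (j : ℕ) → i ∈ backNbhd H j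

/-- A `k`-caterpillar: a `k`-tree in which each new vertex (after the first added
one) is joined to a `k`-clique contained in the maximal `(k+1)`-clique created at
the previous stage. -/
def IsCaterpillarOrd (k : ℕ) (N : ℕ) (H : SimpleGraph (Fin N)) : Prop :=
  IsKTreeOrd k N H ∧
  ∀ i j : Fin N, (i : ℕ) + 1 = (j : ℕ) → k + 1 < (j : ℕ) →
    backNbhd H j ⊆ insert i (backNbhd H i)

/-- A two-sided `k`-tree: a `k`-tree in which each new vertex is joined to a
`k`-clique that either contains a vertex of degree `k` (at that stage) or equals
the `k`-clique to which some previously added vertex was joined. -/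
def IsTwoSidedKTreeOrd (k : ℕ) (N : ℕ) (H : SimpleGraph (Fin N)) : Prop :=
  IsKTreeOrd k N H ∧
  ∀ j : Fin N, k < (j : ℕ) →
    ((∃ u ∈ backNbhd H j, stageDeg H (j : ℕ) u = k) ∨
     (∃ i : Fin N, k < (i : ℕ) ∧ (i : ℕ) < (j : ℕ) ∧ backNbhd H i = backNbhd H j))

/-- The least `k` such that `G` embeds as a subgraph into some graph in the
class `P k`; an edgeless graph gets the value `0`. -/
noncomputable def widthParam (P : ℕ → (N : ℕ) → SimpleGraph (Fin N) → Prop)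
    (n : ℕ) (G : SimpleGraph (Fin n)) : ℕ :=
  if G = ⊥ then 0
  else sInf {k | ∃ (N : ℕ) (H : SimpleGraph (Fin N)) (f : Fin n ↪ Fin N),
    P k N H ∧ ∀ u v : Fin n, G.Adj u v → H.Adj (f u) (f v)}

/-- Tree-width: the least `k` such that `G` is a subgraph of a `k`-tree. -/
noncomputable def treewidth (n : ℕ) (G : SimpleGraph (Fin n)) : ℕ :=
  widthParam IsKTreeOrd n G

/-- Largeur d'arborescence: the least `k` such that `G` is a subgraph of a
two-sided `k`-tree. -/
noncomputable def la (n : ℕ) (G : SimpleGraph (Fin n)) : ℕ :=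
  widthParam IsTwoSidedKTreeOrd n G

/-- Path-width: the least `k` such that `G` is a subgraph of a `k`-caterpillar. -/
noncomputable def pw (n : ℕ) (G : SimpleGraph (Fin n)) : ℕ :=
  widthParam IsCaterpillarOrd n G

/-- Proper path-width: the least `k` such that `G` is a subgraph of a linear
`k`-tree. -/
noncomputable def ppw (n : ℕ) (G : SimpleGraph (Fin n)) : ℕ :=
  widthParam IsLinearKTreeOrd n G

/-- `G` has a complete-graph minor on `m` branch sets: there are `m` pairwise
disjoint nonempty connected vertex sets with an edge between every two of them. -/
def HasCliqueMinor {n : ℕ} (G : SimpleGraph (Fin n)) (m : ℕ) : Prop :=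
  ∃ B : Fin m → Finset (Fin n),
    (∀ p, (B p).Nonempty) ∧
    (∀ p, (G.induce ((B p : Finset (Fin n)) : Set (Fin n))).Connected) ∧
    (∀ p q, p ≠ q → Disjoint (B p) (B q)) ∧
    (∀ p q, p ≠ q → ∃ u ∈ B p, ∃ v ∈ B q, G.Adj u v)

/-- The Hadwiger number: the largest `m` such that `K_m` is a minor of `G`. -/
noncomputable def hadwiger (n : ℕ) (G : SimpleGraph (Fin n)) : ℕ :=
  sSup {m | HasCliqueMinor G m}

/-- `A` is a symmetric matrix whose off-diagonal nonzero pattern is the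
adjacency of `G`. -/
def DescribesGraph {n : ℕ} (A : Matrix (Fin n) (Fin n) ℝ)
    (G : SimpleGraph (Fin n)) : Prop :=
  A.IsSymm ∧ ∀ i j : Fin n, i ≠ j → (A i j ≠ 0 ↔ G.Adj i j)

/-- The Strong Arnold Property: the only symmetric `X` with `AX = O`,
`A∘X = O` and `I∘X = O` is `X = O`. -/
def StrongArnold {n : ℕ} (A : Matrix (Fin n) (Fin n) ℝ) : Prop :=
  ∀ X : Matrix (Fin n) (Fin n) ℝ, X.IsSymm → A * X = 0 →
    (∀ i j, A i j * X i j = 0) → (∀ i, X i i = 0) → X = 0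

/-- The nullity of a square real matrix. -/
noncomputable def nullity {n : ℕ} (A : Matrix (Fin n) (Fin n) ℝ) : ℕ :=
  Module.finrank ℝ (LinearMap.ker (Matrix.toLin' A))

/-- The Colin de Verdière type parameter `ξ`: maximum nullity of a matrix in
`S(G)` with the Strong Arnold Property. -/
noncomputable def xiParam (n : ℕ) (G : SimpleGraph (Fin n)) : ℕ :=
  sSup {m | ∃ A : Matrix (Fin n) (Fin n) ℝ,
    DescribesGraph A G ∧ StrongArnold A ∧ nullity A = m}

/-- The Colin de Verdière type parameter `ν`: maximum nullity of a positive
semidefinite matrix in `S(G)` with the Strong Arnold Property. -/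
noncomputable def nuParam (n : ℕ) (G : SimpleGraph (Fin n)) : ℕ :=
  sSup {m | ∃ A : Matrix (Fin n) (Fin n) ℝ,
    DescribesGraph A G ∧ A.PosSemidef ∧ StrongArnold A ∧ nullity A = m}

/-- The Colin de Verdière number `μ`: maximum nullity of a generalized
Laplacian in `S(G)` with exactly one negative eigenvalue and the Strong Arnold
Property. -/
noncomputable def muParam (n : ℕ) (G : SimpleGraph (Fin n)) : ℕ :=
  sSup {m | ∃ (A : Matrix (Fin n) (Fin n) ℝ) (hA : A.IsHermitian),
    DescribesGraph A G ∧ StrongArnold A ∧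
    (Finset.univ.filter (fun i => hA.eigenvalues i < 0)).card = 1 ∧
    (∀ i j : Fin n, i ≠ j → A i j ≤ 0) ∧ nullity A = m}

/-- An `r`-decomposition of `K_n`: spanning subgraphs with pairwise disjoint
edge sets whose union is all of `K_n`. -/
def IsDecomp {n r : ℕ} (G : Fin r → SimpleGraph (Fin n)) : Prop :=
  (∀ i j : Fin r, i ≠ j → Disjoint (G i) (G j)) ∧ (⨆ i, G i) = ⊤

/-- A non-degenerate `r`-decomposition: every part has at least one edge. -/
def IsNDDecomp {n r : ℕ} (G : Fin r → SimpleGraph (Fin n)) : Prop :=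
  IsDecomp G ∧ ∀ i, G i ≠ ⊥

/-- Nordhaus–Gaddum sum upper bound `NGΣ↑_β(r;n)`. -/
noncomputable def NGsumUp {n : ℕ} (β : SimpleGraph (Fin n) → ℕ) (r : ℕ) : ℕ :=
  sSup {s | ∃ G : Fin r → SimpleGraph (Fin n), IsDecomp G ∧ ∑ i, β (G i) = s}

/-- Nordhaus–Gaddum sum lower bound `NGΣ↓_β(r;n)`. -/
noncomputable def NGsumLow {n : ℕ} (β : SimpleGraph (Fin n) → ℕ) (r : ℕ) : ℕ :=
  sInf {s | ∃ G : Fin r → SimpleGraph (Fin n), IsDecomp G ∧ ∑ i, β (G i) = s}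

/-- Non-degenerate Nordhaus–Gaddum sum lower bound `NGΣ↓ⁿ_β(r;n)`. -/
noncomputable def NGsumLowND {n : ℕ} (β : SimpleGraph (Fin n) → ℕ) (r : ℕ) : ℕ :=
  sInf {s | ∃ G : Fin r → SimpleGraph (Fin n), IsNDDecomp G ∧ ∑ i, β (G i) = s}

/-- Nordhaus–Gaddum product upper bound `NGΠ↑_β(r;n)`. -/
noncomputable def NGprodUp {n : ℕ} (β : SimpleGraph (Fin n) → ℕ) (r : ℕ) : ℕ :=
  sSup {s | ∃ G : Fin r → SimpleGraph (Fin n), IsDecomp G ∧ ∏ i, β (G i) = s}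

/-- Non-degenerate Nordhaus–Gaddum product upper bound `NGΠ↑ⁿ_β(r;n)`. -/
noncomputable def NGprodUpND {n : ℕ} (β : SimpleGraph (Fin n) → ℕ) (r : ℕ) : ℕ :=
  sSup {s | ∃ G : Fin r → SimpleGraph (Fin n), IsNDDecomp G ∧ ∏ i, β (G i) = s}

/-- Nordhaus–Gaddum product lower bound `NGΠ↓_β(r;n)`. -/
noncomputable def NGprodLow {n : ℕ} (β : SimpleGraph (Fin n) → ℕ) (r : ℕ) : ℕ :=
  sInf {s | ∃ G : Fin r → SimpleGraph (Fin n), IsDecomp G ∧ ∏ i, β (G i) = s}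

/-- Non-degenerate Nordhaus–Gaddum product lower bound `NGΠ↓ⁿ_β(r;n)`. -/
noncomputable def NGprodLowND {n : ℕ} (β : SimpleGraph (Fin n) → ℕ) (r : ℕ) : ℕ :=
  sInf {s | ∃ G : Fin r → SimpleGraph (Fin n), IsNDDecomp G ∧ ∏ i, β (G i) = s}

/-- The triangular root `t(r) = ⌈√(2r + 1/4) − 1/2⌉`. -/
noncomputable def trt (r : ℕ) : ℕ := ⌈Real.sqrt (2 * (r : ℝ) + 1 / 4) - 1 / 2⌉₊

/-- `H` is a path together with isolated vertices: its edges are exactly those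
of a path through some list of distinct vertices. -/
def IsPathGraph {n : ℕ} (H : SimpleGraph (Fin n)) : Prop :=
  ∃ (m : ℕ) (f : Fin (m + 1) ↪ Fin n), ∀ u v : Fin n,
    H.Adj u v ↔ ∃ a b : Fin (m + 1), (a : ℕ) + 1 = (b : ℕ) ∧
      ((u = f a ∧ v = f b) ∨ (u = f b ∧ v = f a))

end NG


namespace NGproof
open Finset

lemma count_single {E : Type*} [Fintype E] [DecidableEq E] {q : ℕ} (D : Finset (Fin q))
    (P : (E → Fin q) → Prop) (e : E)
    (hP : ∀ f d, P (Function.update f e d) ↔ P f) :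
    (univ.filter (fun f : E → Fin q => P f ∧ f e ∈ D)).card * q
      = D.card * (univ.filter (fun f : E → Fin q => P f)).card := by
  have h1 : ((univ.filter (fun f : E → Fin q => P f ∧ f e ∈ D)) ×ˢ (univ : Finset (Fin q))).card
      = (D ×ˢ (univ.filter (fun f : E → Fin q => P f))).card := by
    refine Finset.card_nbij' (fun p => (p.1 e, Function.update p.1 e p.2))
      (fun p => (Function.update p.2 e p.1, p.2 e)) ?_ ?_ ?_ ?_
    · rintro ⟨f, x⟩ h
      simp at h ⊢
      exact ⟨h.2, (hP f x).2 h.1⟩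
    · rintro ⟨d, g⟩ h
      simp at h ⊢
      exact ⟨(hP g d).2 h.2, h.1⟩
    · rintro ⟨f, x⟩ h
      simp
    · rintro ⟨d, g⟩ h
      simp
  rw [card_product, card_product] at h1
  simpa using h1

lemma count_many {E : Type*} [Fintype E] [DecidableEq E] {q : ℕ} (D : Finset (Fin q))
    (P : (E → Fin q) → Prop) (F : Finset E)
    (hP : ∀ e ∈ F, ∀ f d, P (Function.update f e d) ↔ P f) :
    (univ.filter (fun f : E → Fin q => P f ∧ ∀ e ∈ F, f e ∈ D)).card * q ^ F.card
      = D.card ^ F.card * (univ.filter (fun f : E → Fin q => P f)).card := by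
  induction F using Finset.induction_on with
  | empty => simp
  | insert e F he ih =>
    have ih' := ih (fun e' h' => hP e' (mem_insert_of_mem h'))
    have h2 := count_single D (fun f => P f ∧ ∀ e ∈ F, f e ∈ D) e (by
      intro f d
      rw [hP e (mem_insert_self _ _)]
      refine and_congr_right (fun _ => forall₂_congr (fun e' h' => ?_))
      rw [Function.update_of_ne]
      rintro rfl; exact he h')
    have h3 : (univ.filter (fun f : E → Fin q => P f ∧ ∀ e' ∈ insert e F, f e' ∈ D))
        = (univ.filter (fun f : E → Fin q => (P f ∧ ∀ e ∈ F, f e ∈ D) ∧ f e ∈ D)) := by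
      ext f; simp; tauto
    rw [h3, card_insert_of_notMem he, pow_succ, pow_succ]
    calc _ = ((univ.filter (fun f : E → Fin q => (P f ∧ ∀ e ∈ F, f e ∈ D) ∧ f e ∈ D)).card * q)
          * q ^ F.card := by ring
      _ = (D.card * (univ.filter (fun f : E → Fin q => P f ∧ ∀ e ∈ F, f e ∈ D)).card)
          * q ^ F.card := by
            congr 1
            convert h2
      _ = _ := by rw [mul_assoc, ih']; ring

lemma count_indep {E κ : Type*} [Fintype E] [DecidableEq E] [DecidableEq κ] {q : ℕ} (hq : 0 < q)
    (C : Finset (Fin q)) (K : Finset κ) (F : κ → Finset E) (M : ℕ)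
    (hd : ∀ k ∈ K, ∀ l ∈ K, k ≠ l → Disjoint (F k) (F l)) (hM : ∀ k ∈ K, (F k).card ≤ M) :
    ((univ.filter (fun f : E → Fin q => ∀ k ∈ K, ∃ e ∈ F k, f e ∈ C)).card : ℝ)
      ≤ (1 - ((Cᶜ.card : ℝ) / q) ^ M) ^ K.card * (Fintype.card (E → Fin q) : ℝ) := by
  have hq' : (0 : ℝ) < q := by exact_mod_cast hq
  have hρ0 : (0 : ℝ) ≤ (Cᶜ.card : ℝ) / q := by positivity
  have hρ1 : (Cᶜ.card : ℝ) / q ≤ 1 := by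
    rw [div_le_one hq']
    exact_mod_cast (by simpa using Finset.card_le_univ (Cᶜ))
  set ρ := (Cᶜ.card : ℝ) / q with hρ
  induction K using Finset.induction_on with
  | empty => simp [Finset.card_univ]
  | insert k K hk ih =>
    have ih' := ih (fun a ha b hb => hd a (mem_insert_of_mem ha) b (mem_insert_of_mem hb))
      (fun a ha => hM a (mem_insert_of_mem ha))
    set P : (E → Fin q) → Prop := fun f => ∀ k ∈ K, ∃ e ∈ F k, f e ∈ C with hPdef
    have h2 := count_many Cᶜ P (F k) (by
      intro e he f d
      refine forall₂_congr (fun l hl => ?_)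
      refine exists_congr (fun e' => and_congr_right (fun he' => ?_))
      rw [Function.update_of_ne]
      rintro rfl
      have := hd k (mem_insert_self _ _) l (mem_insert_of_mem hl) (by rintro rfl; exact hk hl)
      exact (Finset.disjoint_left.1 this he he'))
    have h3 : (univ.filter (fun f : E → Fin q => ∀ l ∈ insert k K, ∃ e ∈ F l, f e ∈ C)).card
        + (univ.filter (fun f : E → Fin q => P f ∧ ∀ e ∈ F k, f e ∈ Cᶜ)).card
        = (univ.filter (fun f : E → Fin q => P f)).card := by
      rw [← Finset.card_filter_add_card_filter_not (s := univ.filter (fun f : E → Fin q => P f))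
        (fun f => ∃ e ∈ F k, f e ∈ C), filter_filter, filter_filter]
      congr 2
      · ext f; simp [P]; tauto
      · ext f; simp
    have h4 : ((univ.filter (fun f : E → Fin q => P f ∧ ∀ e ∈ F k, f e ∈ Cᶜ)).card : ℝ)
        = ρ ^ (F k).card * ((univ.filter (fun f : E → Fin q => P f)).card : ℝ) := by
      rw [hρ, div_pow, div_mul_eq_mul_div, eq_div_iff (by positivity)]
      norm_cast
      convert h2
    have h5 : ρ ^ M ≤ ρ ^ (F k).card :=
      pow_le_pow_of_le_one hρ0 hρ1 (hM k (mem_insert_self _ _))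
    have h6 : ((univ.filter (fun f : E → Fin q => ∀ l ∈ insert k K, ∃ e ∈ F l, f e ∈ C)).card : ℝ)
        = (1 - ρ ^ (F k).card) * ((univ.filter (fun f : E → Fin q => P f)).card : ℝ) := by
      have : ((univ.filter (fun f : E → Fin q => ∀ l ∈ insert k K, ∃ e ∈ F l, f e ∈ C)).card : ℝ)
        + ((univ.filter (fun f : E → Fin q => P f ∧ ∀ e ∈ F k, f e ∈ Cᶜ)).card : ℝ)
        = ((univ.filter (fun f : E → Fin q => P f)).card : ℝ) := by exact_mod_cast h3
      rw [h4] at this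
      linarith
    rw [h6, card_insert_of_notMem hk, pow_succ]
    have h7 : 0 ≤ 1 - ρ ^ M := by linarith [pow_le_one₀ (n := M) hρ0 hρ1]
    calc _ ≤ (1 - ρ ^ M) * ((univ.filter (fun f : E → Fin q => P f)).card : ℝ) := by
            gcongr
      _ ≤ (1 - ρ ^ M) * ((1 - ρ ^ M) ^ K.card * (Fintype.card (E → Fin q) : ℝ)) := by
            gcongr
      _ = _ := by ring

end NGproof

namespace NGproof
open Finset

/-- graph of colours in `C` -/
def colG {n q : ℕ} (f : Sym2 (Fin n) → Fin q) (C : Finset (Fin q)) : SimpleGraph (Fin n) where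
  Adj u v := u ≠ v ∧ f s(u, v) ∈ C
  symm := ⟨fun u v h => ⟨h.1.symm, by rw [Sym2.eq_swap]; exact h.2⟩⟩
  loopless := ⟨fun u h => h.1 rfl⟩

/-- family of small sets -/
def SmallFam {n : ℕ} (G : SimpleGraph (Fin n)) (a m : ℕ) : Prop :=
  ∃ g : Fin m ⊕ Fin m → Fin a → Fin n, (∀ p p', p ≠ p' → ∀ x y, g p x ≠ g p' y) ∧
    ∀ i j, ∃ x y, G.Adj (g (Sum.inl i) x) (g (Sum.inr j) y)

lemma count_bad {n q : ℕ} (hq : 0 < q) (C : Finset (Fin q)) (a m : ℕ) :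
    ((univ.filter (fun f : Sym2 (Fin n) → Fin q => SmallFam (colG f C) a m)).card : ℝ)
      ≤ ((n : ℝ) ^ a) ^ (m + m) * ((1 - ((Cᶜ.card : ℝ) / q) ^ (a * a)) ^ (m * m)
        * (Fintype.card (Sym2 (Fin n) → Fin q) : ℝ)) := by
  set X := (1 - ((Cᶜ.card : ℝ) / q) ^ (a * a)) ^ (m * m)
        * (Fintype.card (Sym2 (Fin n) → Fin q) : ℝ) with hX
  let S : Finset (Fin m ⊕ Fin m → Fin a → Fin n) :=
    univ.filter (fun g => ∀ p p', p ≠ p' → ∀ x y, g p x ≠ g p' y)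
  let F : (Fin m ⊕ Fin m → Fin a → Fin n) → Fin m × Fin m → Finset (Sym2 (Fin n)) :=
    fun g ij => (univ : Finset (Fin a × Fin a)).image
      (fun xy => s(g (Sum.inl ij.1) xy.1, g (Sum.inr ij.2) xy.2))
  let Bd : (Fin m ⊕ Fin m → Fin a → Fin n) → Finset (Sym2 (Fin n) → Fin q) := fun g =>
    univ.filter (fun f => ∀ k ∈ (univ : Finset (Fin m × Fin m)), ∃ e ∈ F g k, f e ∈ C)
  have hsub : univ.filter (fun f : Sym2 (Fin n) → Fin q => SmallFam (colG f C) a m)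
      ⊆ S.biUnion Bd := by
    intro f hf
    obtain ⟨g, hg1, hg2⟩ := (mem_filter.1 hf).2
    refine mem_biUnion.2 ⟨g, by simp only [S, mem_filter, mem_univ, true_and]; exact hg1, ?_⟩
    simp only [Bd, mem_filter, mem_univ, true_and]
    rintro ⟨i, j⟩ -
    obtain ⟨x, y, hxy⟩ := hg2 i j
    exact ⟨_, mem_image.2 ⟨(x, y), mem_univ _, rfl⟩, hxy.2⟩
  have hone : ∀ g ∈ S, ((Bd g).card : ℝ) ≤ X := by
    intro g hg
    have hg' : ∀ p p', p ≠ p' → ∀ x y, g p x ≠ g p' y := (mem_filter.1 hg).2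
    have := count_indep hq C (univ : Finset (Fin m × Fin m)) (F g) (a * a) (by
      rintro ⟨i, j⟩ - ⟨i', j'⟩ - hne
      rw [Finset.disjoint_left]
      intro e he he'
      obtain ⟨⟨x, y⟩, -, rfl⟩ := mem_image.1 he
      obtain ⟨⟨x', y'⟩, -, h⟩ := mem_image.1 he'
      simp only [Sym2.eq_iff] at h
      rcases h with ⟨h1, h2⟩ | ⟨h1, h2⟩
      · apply hne
        have hi : i' = i := by
          by_contra hc
          exact hg' (Sum.inl i') (Sum.inl i) (by simpa using hc) _ _ h1
        have hj : j' = j := by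
          by_contra hc
          exact hg' (Sum.inr j') (Sum.inr j) (by simpa using hc) _ _ h2
        rw [hi, hj]
      · exact hg' (Sum.inl i') (Sum.inr j) (by simp) _ _ h1) (by
      intro k _
      refine card_image_le.trans ?_
      simp)
    rw [hX]
    convert this using 4
    · simp
  have hX0 : S.card ≤ (n ^ a) ^ (m + m) := by
    refine (card_le_univ S).trans ?_
    simp
  have hXn : 0 ≤ X := by
    have hq' : (0 : ℝ) < q := by exact_mod_cast hq
    have hρ0 : (0 : ℝ) ≤ (Cᶜ.card : ℝ) / q := by positivity
    have hρ1 : (Cᶜ.card : ℝ) / q ≤ 1 := by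
      rw [div_le_one hq']
      exact_mod_cast (by simpa using Finset.card_le_univ (Cᶜ))
    have := pow_le_one₀ (n := a * a) hρ0 hρ1
    have h1 : 0 ≤ 1 - ((Cᶜ.card : ℝ) / q) ^ (a * a) := by linarith
    positivity
  calc _ ≤ ((S.biUnion Bd).card : ℝ) := by exact_mod_cast card_le_card hsub
    _ ≤ ∑ g ∈ S, ((Bd g).card : ℝ) := by exact_mod_cast card_biUnion_le
    _ ≤ ∑ g ∈ S, X := sum_le_sum hone
    _ = S.card * X := by simp
    _ ≤ _ := by
      gcongr
      exact_mod_cast hX0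

lemma exists_fun_range {n a : ℕ} (B : Finset (Fin n)) (hB : B.Nonempty) (h : B.card ≤ a) :
    ∃ g : Fin a → Fin n, ∀ u, u ∈ B ↔ ∃ x, g x = u := by
  have : Nonempty B := hB.to_subtype
  obtain ⟨e⟩ := Function.Embedding.nonempty_of_card_le (α := B) (β := Fin a) (by simpa using h)
  have hs := Function.invFun_surjective e.injective
  refine ⟨fun x => (Function.invFun e x : B).1, fun u => ⟨fun hu => ?_, ?_⟩⟩
  · obtain ⟨x, hx⟩ := hs ⟨u, hu⟩
    exact ⟨x, congrArg Subtype.val hx⟩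
  · rintro ⟨x, rfl⟩
    exact (Function.invFun e x : B).2

lemma minor_small {n : ℕ} (G : SimpleGraph (Fin n)) (a k : ℕ) (ha : 1 ≤ a)
    (hk : NG.HasCliqueMinor G k) (hlt : 8 * n < k * (8 * a + 7)) :
    SmallFam G a (n / (16 * a * (a + 1))) := by
  obtain ⟨B, hne, -, hdis, hadj⟩ := hk
  set m := n / (16 * a * (a + 1)) with hm
  let Sm : Finset (Fin k) := univ.filter (fun p => (B p).card ≤ a)
  have h1 : ∑ p, (B p).card ≤ n := by
    rw [← card_biUnion (fun p _ q _ h => hdis p q h)]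
    simpa using card_le_univ (univ.biUnion B)
  have h2 : ∑ p : Fin k, (a + 1) ≤ ∑ p, ((B p).card + if (B p).card ≤ a then a else 0) := by
    refine sum_le_sum (fun p _ => ?_)
    have := (hne p).card_pos
    split_ifs <;> omega
  rw [sum_add_distrib (s := univ) (f := fun p => (B p).card), ← sum_filter, sum_const, sum_const, card_univ, Fintype.card_fin] at h2
  change k • (a + 1) ≤ _ + Sm.card • a at h2
  simp only [smul_eq_mul] at h2
  have h3 : m * (16 * a * (a + 1)) ≤ n := Nat.div_mul_le_self _ _
  have h4 : 2 * m < Sm.card := by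
    have e1 : k < 8 * a * Sm.card := by nlinarith
    have e2 : n < k * (a + 1) := by nlinarith
    have e3 : 16 * a * m < k := by
      by_contra hc
      push Not at hc
      have := Nat.mul_le_mul_right (a + 1) hc
      nlinarith
    by_contra hc
    push Not at hc
    have := Nat.mul_le_mul_left (8 * a) hc
    nlinarith
  obtain ⟨e⟩ := Function.Embedding.nonempty_of_card_le (α := Fin m ⊕ Fin m) (β := Sm)
    (by simp; omega)
  have hs : ∀ p : Sm, (B p.1).card ≤ a := fun p => (mem_filter.1 p.2).2
  choose g hg using fun p : Fin m ⊕ Fin m => exists_fun_range (B (e p).1) (hne _) (hs (e p))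
  have hne' : ∀ p p', p ≠ p' → (e p).1 ≠ (e p').1 := fun p p' h h' =>
    h (e.injective (Subtype.ext h'))
  refine ⟨g, ?_, ?_⟩
  · intro p p' hp x y hxy
    refine Finset.disjoint_left.1 (hdis _ _ (hne' p p' hp)) ((hg p _).2 ⟨x, rfl⟩) ?_
    rw [hxy]
    exact (hg p' _).2 ⟨y, rfl⟩
  · intro i j
    obtain ⟨u, hu, v, hv, huv⟩ := hadj _ _ (hne' (Sum.inl i) (Sum.inr j) (by simp))
    obtain ⟨x, rfl⟩ := (hg _ _).1 hu
    obtain ⟨y, rfl⟩ := (hg _ _).1 hv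
    exact ⟨x, y, huv⟩

lemma minor_bdd {n : ℕ} (G : SimpleGraph (Fin n)) : BddAbove {m | NG.HasCliqueMinor G m} := by
  refine ⟨n, ?_⟩
  rintro k ⟨B, hne, -, hdis, -⟩
  have h1 : ∑ p, (B p).card ≤ n := by
    rw [← card_biUnion (fun p _ q _ h => hdis p q h)]
    simpa using card_le_univ (univ.biUnion B)
  have h2 : ∑ p : Fin k, 1 ≤ ∑ p, (B p).card := sum_le_sum (fun p _ => (hne p).card_pos)
  simp at h2
  omega

lemma minor_zero {n : ℕ} (G : SimpleGraph (Fin n)) : NG.HasCliqueMinor G 0 :=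
  ⟨fun _ => ∅, fun p => p.elim0, fun p => p.elim0, fun p => p.elim0, fun p => p.elim0⟩

lemma hadwiger_minor {n : ℕ} (G : SimpleGraph (Fin n)) :
    NG.HasCliqueMinor G (NG.hadwiger n G) :=
  Nat.sSup_mem ⟨0, minor_zero G⟩ (minor_bdd G)

lemma hadwiger_bot (n : ℕ) : NG.hadwiger n ⊥ ≤ 1 := by
  obtain ⟨B, _, _, _, h⟩ := hadwiger_minor (⊥ : SimpleGraph (Fin n))
  by_contra hc
  push Not at hc
  obtain ⟨u, _, v, _, huv⟩ := h ⟨0, by omega⟩ ⟨1, by omega⟩ (by simp)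
  exact huv

lemma prob_small {n a m : ℕ} (ρ : ℝ) (h0 : 0 ≤ ρ) (h1 : ρ ≤ 1) (hn : 1 ≤ n) (hm : 1 ≤ m)
    (h : 2 * a * Real.log n + 1 < m * ρ ^ (a * a)) :
    ((n : ℝ) ^ a) ^ (m + m) * (1 - ρ ^ (a * a)) ^ (m * m) < 1 / 2 := by
  have hn' : (0 : ℝ) < n := by exact_mod_cast hn
  have hm' : (1 : ℝ) ≤ m := by exact_mod_cast hm
  have hp := pow_le_one₀ (n := a * a) h0 h1
  set x := ρ ^ (a * a) with hx
  have e1 : (1 - x) ^ (m * m) ≤ Real.exp (-(x * (m * m))) := by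
    have := Real.one_sub_le_exp_neg x
    calc (1 - x) ^ (m * m) ≤ (Real.exp (-x)) ^ (m * m) := by
          gcongr
      _ = _ := by
          rw [← Real.exp_nat_mul]
          push_cast
          congr 1
          ring
  have e2 : ((n : ℝ) ^ a) ^ (m + m) = Real.exp (2 * a * m * Real.log n) := by
    rw [← pow_mul, ← Real.exp_log hn', ← Real.exp_nat_mul, Real.exp_log hn']
    push_cast
    congr 1
    ring
  calc _ ≤ Real.exp (2 * a * m * Real.log n) * Real.exp (-(x * (m * m))) := by
        rw [e2]; gcongr
    _ = Real.exp (2 * a * m * Real.log n + -(x * (m * m))) := by rw [Real.exp_add]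
    _ < Real.exp (-1) := by
        rw [Real.exp_lt_exp]
        nlinarith
    _ ≤ 1 / 2 := by
        rw [Real.exp_neg, one_div]
        gcongr
        linarith [Real.add_one_le_exp (1 : ℝ)]

lemma exists_good_graph {n q a b : ℕ} (hq : 0 < q) (hn : 1 ≤ n) (ha : 1 ≤ a) (hb : 1 ≤ b)
    (C : Finset (Fin q))
    (h1 : 2 * a * Real.log n + 1 < ((n / (16 * a * (a + 1)) : ℕ) : ℝ)
      * ((Cᶜ.card : ℝ) / q) ^ (a * a))
    (h2 : 2 * b * Real.log n + 1 < ((n / (16 * b * (b + 1)) : ℕ) : ℝ)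
      * ((C.card : ℝ) / q) ^ (b * b)) :
    ∃ G : SimpleGraph (Fin n), NG.hadwiger n G * (8 * a + 7) ≤ 8 * n ∧
      NG.hadwiger n Gᶜ * (8 * b + 7) ≤ 8 * n := by
  have hlog : 0 ≤ Real.log n := Real.log_nonneg (by exact_mod_cast hn)
  have hq' : (0 : ℝ) < q := by exact_mod_cast hq
  have key : ∀ (D : Finset (Fin q)) (a : ℕ), 
      2 * a * Real.log n + 1 < ((n / (16 * a * (a + 1)) : ℕ) : ℝ)
        * ((Dᶜ.card : ℝ) / q) ^ (a * a) → 
      ((univ.filter (fun f : Sym2 (Fin n) → Fin q =>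
        SmallFam (colG f D) a (n / (16 * a * (a + 1))))).card : ℝ)
        < 1 / 2 * (Fintype.card (Sym2 (Fin n) → Fin q) : ℝ) := by
    intro D a h
    have hρ0 : (0 : ℝ) ≤ (Dᶜ.card : ℝ) / q := by positivity
    have hρ1 : (Dᶜ.card : ℝ) / q ≤ 1 := by
      rw [div_le_one hq']
      exact_mod_cast (by simpa using Finset.card_le_univ (Dᶜ))
    have hm : 1 ≤ n / (16 * a * (a + 1)) := by
      by_contra hc
      have : n / (16 * a * (a + 1)) = 0 := Nat.lt_one_iff.1 (not_le.1 hc)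
      rw [this] at h
      have : 0 ≤ 2 * a * Real.log n := by positivity
      simp at h
      linarith
    have h3 := prob_small _ hρ0 hρ1 hn hm h
    refine (count_bad hq D a (n / (16 * a * (a + 1)))).trans_lt ?_
    rw [← mul_assoc]
    refine mul_lt_mul_of_pos_right h3 ?_
    have : NeZero q := ⟨hq.ne'⟩
    exact_mod_cast Fintype.card_pos
  have k1 := key C a h1
  have k2 := key Cᶜ b (by rw [compl_compl]; exact h2)
  have : ∃ f : Sym2 (Fin n) → Fin q, ¬ SmallFam (colG f C) a (n / (16 * a * (a + 1))) ∧
      ¬ SmallFam (colG f Cᶜ) b (n / (16 * b * (b + 1))) := by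
    by_contra hc
    push Not at hc
    have hsub : (univ : Finset (Sym2 (Fin n) → Fin q)) ⊆ 
      univ.filter (fun f => SmallFam (colG f C) a (n / (16 * a * (a + 1)))) ∪
      univ.filter (fun f => SmallFam (colG f Cᶜ) b (n / (16 * b * (b + 1)))) := by
      intro f _
      simp only [mem_union, mem_filter, mem_univ, true_and]
      by_cases h : SmallFam (colG f C) a (n / (16 * a * (a + 1)))
      · exact Or.inl h
      · exact Or.inr (hc f h)
    have h5 := (card_le_card hsub).trans (card_union_le _ _)
    rw [card_univ] at h5
    have h6 : (Fintype.card (Sym2 (Fin n) → Fin q) : ℝ) ≤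
      ((univ.filter (fun f : Sym2 (Fin n) → Fin q =>
        SmallFam (colG f C) a (n / (16 * a * (a + 1))))).card : ℝ) + 
      ((univ.filter (fun f : Sym2 (Fin n) → Fin q =>
        SmallFam (colG f Cᶜ) b (n / (16 * b * (b + 1))))).card : ℝ) := by exact_mod_cast h5
    linarith
  obtain ⟨f, hf1, hf2⟩ := this
  refine ⟨colG f C, ?_, ?_⟩
  · by_contra hc
    exact hf1 (minor_small _ a _ ha (hadwiger_minor _) (by omega))
  · have : (colG f C)ᶜ = colG f Cᶜ := by
      ext u v
      simp [colG]
      tauto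
    rw [this]
    by_contra hc
    exact hf2 (minor_small _ b _ hb (hadwiger_minor _) (by omega))

lemma NGsumLow_le {n r : ℕ} (hr : 2 ≤ r) (G : SimpleGraph (Fin n)) :
    NG.NGsumLow (NG.hadwiger n) r ≤ NG.hadwiger n G + NG.hadwiger n Gᶜ + (r - 2) := by
  obtain ⟨r, rfl⟩ : ∃ r', r = r' + 2 := ⟨r - 2, by omega⟩
  let D : Fin (r + 2) → SimpleGraph (Fin n) := Fin.cons G (Fin.cons Gᶜ (fun _ => ⊥))
  have hD : NG.IsDecomp D := by
    constructor
    · intro i j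
      refine Fin.cases ?_ (fun i => ?_) i <;> refine Fin.cases ?_ (fun j => ?_) j
      · simp
      · intro _
        refine Fin.cases ?_ (fun j => ?_) j
        · exact disjoint_compl_right
        · exact disjoint_bot_right
      · intro _
        refine Fin.cases ?_ (fun j => ?_) i
        · exact disjoint_compl_left
        · exact disjoint_bot_left
      · refine Fin.cases ?_ (fun i => ?_) i <;> refine Fin.cases ?_ (fun j => ?_) j
        · simp
        · intro _
          exact disjoint_bot_right
        · intro _
          exact disjoint_bot_left
        · intro _
          exact disjoint_bot_left
    · rw [eq_top_iff, ← sup_compl_eq_top (x := G)]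
      exact sup_le (le_iSup D 0) (le_iSup D 1)
  have h0 : NG.NGsumLow (NG.hadwiger n) (r + 2) ≤ ∑ i, NG.hadwiger n (D i) :=
    Nat.sInf_le ⟨D, hD, rfl⟩
  refine h0.trans ?_
  rw [Fin.sum_univ_succ, Fin.sum_univ_succ]
  simp only [D, Fin.cons_zero, Fin.cons_succ, sum_const, card_univ, Fintype.card_fin, smul_eq_mul]
  have := Nat.mul_le_mul_left r (hadwiger_bot n)
  omega

end NGproof

namespace NGproof
open Finset

lemma growth : ∀ᶠ a : ℕ in Filter.atTop,
    16 * (a : ℝ) * (a + 1) * (2 * a * (a + 3) ^ 2 + 3) ≤ (2 : ℝ) ^ ((a : ℝ) / 8) := by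
  have h1 : (1 : ℝ) < (2 : ℝ) ^ ((1 : ℝ) / 8) := Real.one_lt_rpow (by norm_num) (by norm_num)
  have h2 := tendsto_pow_const_div_const_pow_of_one_lt 6 h1
  have h3 := h2.eventually (gt_mem_nhds (show (0 : ℝ) < 1 by norm_num))
  filter_upwards [h3, Filter.eventually_ge_atTop 2000] with a ha ha2
  have ha3 : (2000 : ℝ) ≤ a := by exact_mod_cast ha2
  rw [div_lt_one (by positivity), ← Real.rpow_natCast, ← Real.rpow_natCast, ← Real.rpow_mul (by norm_num)] at ha
  have : (1 : ℝ) / 8 * a = a / 8 := by ring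
  rw [this] at ha
  refine le_trans ?_ ha.le
  have e : (a : ℝ) ^ (((6 : ℕ) : ℝ)) = (a : ℝ) ^ 6 := by rw [Real.rpow_natCast]
  rw [e]
  calc 16 * (a : ℝ) * (a + 1) * (2 * a * (a + 3) ^ 2 + 3)
      ≤ 16 * (a : ℝ) * (a + a) * (2 * a * (a + a) ^ 2 + a ^ 3) := by
        gcongr
        · linarith
        · linarith
        · nlinarith [sq_nonneg (a : ℝ)]
    _ = 288 * (a : ℝ) ^ 5 := by ring
    _ ≤ a * (a : ℝ) ^ 5 := by gcongr; linarith
    _ = _ := by ring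

lemma anal {a n : ℕ} (ha1 : 1 ≤ a) (hn : 1 ≤ n)
    (hg : 16 * (a : ℝ) * (a + 1) * (2 * a * (a + 3) ^ 2 + 3) ≤ (2 : ℝ) ^ ((a : ℝ) / 8))
    (ρ c : ℝ) (hρ1 : ρ ≤ 1) (hc : (2 : ℝ) ^ (-c) ≤ ρ)
    (hL : (a : ℝ) / 8 ≤ Real.logb 2 n - c * a ^ 2)
    (hL2 : Real.logb 2 n ≤ (a + 3) ^ 2) :
    2 * a * Real.log n + 1 < ((n / (16 * a * (a + 1)) : ℕ) : ℝ) * ρ ^ (a * a) := by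
  have hn' : (0 : ℝ) < n := by exact_mod_cast hn
  have ha' : (1 : ℝ) ≤ a := by exact_mod_cast ha1
  have hρ0 : 0 ≤ ρ := le_trans (by positivity) hc
  have e1 : (2 : ℝ) ^ (-(c * a ^ 2)) ≤ ρ ^ (a * a) := by
    calc (2 : ℝ) ^ (-(c * a ^ 2)) = ((2 : ℝ) ^ (-c)) ^ (a * a) := by
          rw [← Real.rpow_natCast ((2 : ℝ) ^ (-c)), ← Real.rpow_mul (by norm_num)]
          push_cast
          congr 1
          ring
      _ ≤ _ := by gcongr
  have e2 : (2 : ℝ) ^ (Real.logb 2 n) = n := Real.rpow_logb (by norm_num) (by norm_num) hn'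
  have e3 : (2 : ℝ) ^ ((a : ℝ) / 8) ≤ n * ρ ^ (a * a) := by
    calc (2 : ℝ) ^ ((a : ℝ) / 8) ≤ (2 : ℝ) ^ (Real.logb 2 n - c * a ^ 2) :=
          Real.rpow_le_rpow_of_exponent_le (by norm_num) hL
      _ = n * (2 : ℝ) ^ (-(c * a ^ 2)) := by
          rw [sub_eq_add_neg, Real.rpow_add (by norm_num), e2]
      _ ≤ _ := by gcongr
  have e4 : Real.log n ≤ (a + 3) ^ 2 := by
    have h0 : 0 ≤ Real.logb 2 n := Real.logb_nonneg (by norm_num) (by exact_mod_cast hn)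
    have : Real.log n = Real.logb 2 n * Real.log 2 := by
      rw [Real.logb, div_mul_cancel₀]
      exact (Real.log_pos (by norm_num)).ne'
    rw [this]
    have h2 : Real.log 2 ≤ 1 := by linarith [Real.log_two_lt_d9]
    nlinarith
  have hM : (0 : ℝ) < 16 * a * (a + 1) := by positivity
  have e5 : (n : ℝ) / (16 * a * (a + 1)) - 1 < ((n / (16 * a * (a + 1)) : ℕ) : ℝ) := by
    have := Nat.lt_div_mul_add (a := n) (b := 16 * a * (a + 1)) (by positivity)
    have h : (n : ℝ) < ((n / (16 * a * (a + 1)) : ℕ) : ℝ) * (16 * a * (a + 1)) + 16 * a * (a + 1) := by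
      exact_mod_cast this
    rw [sub_lt_iff_lt_add, div_lt_iff₀ hM]
    linarith
  have hp : ρ ^ (a * a) ≤ 1 := pow_le_one₀ hρ0 hρ1
  have hp0 : 0 ≤ ρ ^ (a * a) := by positivity
  have e6 : 2 * a * (a + 3) ^ 2 + 3 ≤ (n : ℝ) / (16 * a * (a + 1)) * ρ ^ (a * a) := by
    rw [div_mul_eq_mul_div, le_div_iff₀ hM]
    linarith
  calc 2 * a * Real.log n + 1 ≤ 2 * a * (a + 3) ^ 2 + 1 := by gcongr
    _ < (n : ℝ) / (16 * a * (a + 1)) * ρ ^ (a * a) - ρ ^ (a * a) := by linarith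
    _ = ((n : ℝ) / (16 * a * (a + 1)) - 1) * ρ ^ (a * a) := by ring
    _ ≤ _ := by gcongr

lemma frac_ineq (n b : ℝ) (hn : 0 ≤ n) (hb : 1 ≤ b) :
    n / (b + 1 + 7 / 8) + n / (b + 7 / 8) ≤ 2 * (n / (b + 9 / 8)) := by
  have h1 : n / (b + 1 + 7 / 8) + n / (b + 7 / 8)
    = n * (1 / (b + 1 + 7 / 8) + 1 / (b + 7 / 8)) := by ring
  rw [h1]
  have h2 : 2 * (n / (b + 9 / 8)) = n * (2 / (b + 9 / 8)) := by ring
  rw [h2]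
  refine mul_le_mul_of_nonneg_left ?_ hn
  rw [div_add_div _ _ (by positivity) (by positivity),
    div_le_div_iff₀ (by positivity) (by positivity)]
  nlinarith

set_option maxHeartbeats 1000000 in
lemma upper_real (r : ℕ) (hr : 2 ≤ r) : ∀ᶠ n : ℕ in Filter.atTop,
    (NG.NGsumLow (NG.hadwiger n) r : ℝ) ≤ (r : ℝ) * n / Real.sqrt (Real.logb 2 n) := by
  obtain ⟨a0, ha0⟩ := Filter.eventually_atTop.1 growth
  have hx : Filter.Tendsto (fun n : ℕ => Real.sqrt (Real.logb 2 n)) Filter.atTop Filter.atTop :=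
    Real.tendsto_sqrt_atTop.comp ((Real.tendsto_logb_atTop (by norm_num)).comp
      tendsto_natCast_atTop_atTop)
  filter_upwards [hx.eventually_ge_atTop ((a0 : ℝ) + 10), Filter.eventually_ge_atTop 1]
    with n hxn hn
  set L := Real.logb 2 n with hLdef
  set x := Real.sqrt L with hxdef
  have hn' : (1 : ℝ) ≤ n := by exact_mod_cast hn
  have hL0 : 0 ≤ L := Real.logb_nonneg (by norm_num) hn'
  have hxL : x ^ 2 = L := Real.sq_sqrt hL0
  have ha00 : (0 : ℝ) ≤ a0 := by positivity
  have hx0 : 0 < x := by linarith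
  have hxn' : x ≤ n := by
    have h1 : L ≤ n := by
      rw [hLdef, Real.logb, div_le_iff₀ (Real.log_pos (by norm_num))]
      have h2 := Real.log_two_gt_d9
      have h3 : Real.log n ≤ n / 2 := by
        have := Real.log_le_sub_one_of_pos (show (0:ℝ) < n / 2 by positivity)
        rw [Real.log_div (by positivity) (by norm_num)] at this
        linarith [Real.log_two_lt_d9]
      nlinarith
    nlinarith
  suffices h : ∃ G : SimpleGraph (Fin n),
      (NG.hadwiger n G : ℝ) + NG.hadwiger n Gᶜ ≤ 2 * (n / x) by
    obtain ⟨G, hG⟩ := h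
    have h1 : (NG.NGsumLow (NG.hadwiger n) r : ℝ) ≤
      NG.hadwiger n G + NG.hadwiger n Gᶜ + ((r - 2 : ℕ) : ℝ) := by
      exact_mod_cast NGsumLow_le hr G
    rw [Nat.cast_sub hr] at h1
    have h2 : 1 ≤ n / x := by rwa [one_le_div hx0]
    have h3 : (2 : ℝ) ≤ r := by exact_mod_cast hr
    rw [mul_div_assoc]
    push_cast at h1
    nlinarith
  have conv : ∀ (h a : ℕ), h * (8 * a + 7) ≤ 8 * n → (h : ℝ) ≤ n / (a + 7 / 8) := by
    intro h a hh
    rw [le_div_iff₀ (by positivity)]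
    have : (h : ℝ) * (8 * a + 7) ≤ 8 * n := by exact_mod_cast hh
    linarith
  by_cases hcase : ∃ a : ℕ, (a : ℝ) + 1 / 8 ≤ x ∧ x ≤ a + 7 / 8
  · obtain ⟨a, hax, hxa⟩ := hcase
    have haa : a0 ≤ a := by
      have : (a0 : ℝ) ≤ a := by linarith
      exact_mod_cast this
    have ha1 : 1 ≤ a := by
      have : (1 : ℝ) ≤ a := by linarith
      exact_mod_cast this
    have hb := anal ha1 hn (ha0 a haa) (1 / 2) 1 (by norm_num) (by norm_num [Real.rpow_neg_one])
      (by rw [← hLdef, ← hxL]; nlinarith) (by rw [← hLdef, ← hxL]; nlinarith)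
    obtain ⟨G, h1, h2⟩ := exists_good_graph (q := 2) (by norm_num) hn ha1 ha1 {0}
      (by simpa [Finset.card_compl] using hb) (by simpa using hb)
    refine ⟨G, ?_⟩
    have h1' := conv _ _ h1
    have h2' := conv _ _ h2
    have : (n : ℝ) / (a + 7 / 8) ≤ n / x := by gcongr
    linarith
  · have hA : ∃ A : ℕ, |x - A| ≤ 1 / 8 := by
      push Not at hcase
      have h1 := Nat.floor_le hx0.le
      have h2 := Nat.lt_floor_add_one x
      rcases le_or_gt ((⌊x⌋₊ : ℝ) + 1 / 8) x with h | h
      · have := hcase _ h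
        refine ⟨⌊x⌋₊ + 1, ?_⟩
        push_cast
        rw [abs_le]
        constructor <;> linarith
      · refine ⟨⌊x⌋₊, ?_⟩
        rw [abs_le]
        constructor <;> linarith
    obtain ⟨A, hA⟩ := hA
    rw [abs_le] at hA
    obtain ⟨b, rfl⟩ : ∃ b, A = b + 1 := by
      refine ⟨A - 1, ?_⟩
      have : (1 : ℝ) ≤ A := by linarith
      have : 1 ≤ A := by exact_mod_cast this
      omega
    push_cast at hA
    have hba : a0 ≤ b := by
      have : (a0 : ℝ) ≤ b := by linarith
      exact_mod_cast this
    have hb1' : (1 : ℝ) ≤ b := by linarith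
    have hb1 : 1 ≤ b := by exact_mod_cast hb1'
    obtain ⟨C, -, hC⟩ := Finset.exists_subset_card_eq (s := (univ : Finset (Fin (4 * (b + 1)))))
      (n := 2 * b + 1) (by simp; omega)
    have hCc : Cᶜ.card = 2 * b + 3 := by
      rw [card_compl, hC, Fintype.card_fin]; omega
    have hc1 : (2 : ℝ) ^ (-(1 - 1 / (2 * ((b : ℝ) + 1)))) ≤
        ((2 * b + 3 : ℕ) : ℝ) / ((4 * (b + 1) : ℕ) : ℝ) := by
      have hy : (2 : ℝ) ^ (1 / (2 * ((b : ℝ) + 1))) ≤ 1 + 1 / (2 * ((b : ℝ) + 1)) * 1 := by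
        have := _root_.rpow_one_add_le_one_add_mul_self (s := 1) (p := 1 / (2 * ((b : ℝ) + 1)))
          (by norm_num) (by positivity) (by rw [div_le_one (by positivity)]; linarith)
        norm_num at this ⊢
        linarith
      have : -(1 - 1 / (2 * ((b : ℝ) + 1))) = 1 / (2 * ((b : ℝ) + 1)) + -1 := by ring
      rw [this, Real.rpow_add (by norm_num), Real.rpow_neg_one]
      calc _ ≤ (1 + 1 / (2 * ((b : ℝ) + 1)) * 1) * 2⁻¹ := by gcongr
        _ = _ := by
          push_cast
          field_simp
          ring
    have hc2 : (2 : ℝ) ^ (-(1 + 1 / (b : ℝ))) ≤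
        ((2 * b + 1 : ℕ) : ℝ) / ((4 * (b + 1) : ℕ) : ℝ) := by
      have h2e : Real.exp (1 / (2 * b + 1)) ≤ (2 : ℝ) ^ (1 / (b : ℝ)) := by
        rw [Real.rpow_def_of_pos (by norm_num), Real.exp_le_exp]
        have := Real.log_two_gt_d9
        rw [mul_one_div, div_le_div_iff₀ (by positivity) (by positivity)]
        nlinarith
      have h3 : 1 / (2 * (b : ℝ) + 1) + 1 ≤ Real.exp (1 / (2 * b + 1)) := Real.add_one_le_exp _
      have h4 : -(1 + 1 / (b : ℝ)) = -(1 / (b : ℝ)) + -1 := by ring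
      rw [h4, Real.rpow_add (by norm_num), Real.rpow_neg_one, Real.rpow_neg (by norm_num)]
      calc _ ≤ (1 / (2 * (b : ℝ) + 1) + 1)⁻¹ * 2⁻¹ := by
            gcongr
            linarith
        _ = _ := by
          push_cast
          field_simp
          ring
    have hx1 : (b : ℝ) + 7 / 8 ≤ x := by linarith
    have hx2 : x ≤ (b : ℝ) + 9 / 8 := by linarith
    have hLl : ((b : ℝ) + 7 / 8) ^ 2 ≤ L := by rw [← hxL]; gcongr
    have hLu : L ≤ ((b : ℝ) + 9 / 8) ^ 2 := by rw [← hxL]; gcongr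
    have g1 := anal (a := b + 1) (by omega) hn (ha0 _ (by omega)) _ _
      (by rw [div_le_one (by positivity)]; norm_cast; omega) hc1
      (by
        rw [← hLdef]
        have : (1 - 1 / (2 * ((b : ℝ) + 1))) * ((b : ℝ) + 1) ^ 2 = ((b : ℝ) + 1) ^ 2 - (b + 1) / 2 := by
          field_simp
        push_cast
        rw [this]
        nlinarith) (by rw [← hLdef]; push_cast; nlinarith)
    have g2 := anal (a := b) hb1 hn (ha0 _ hba) _ _
      (by rw [div_le_one (by positivity)]; norm_cast; omega) hc2
      (by
        rw [← hLdef]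
        have : (1 + 1 / (b : ℝ)) * (b : ℝ) ^ 2 = (b : ℝ) ^ 2 + b := by
          field_simp
        rw [this]
        nlinarith) (by rw [← hLdef]; nlinarith)
    obtain ⟨G, h1, h2⟩ := exists_good_graph (q := 4 * (b + 1)) (a := b + 1) (b := b) (by omega) hn (by omega) hb1 C
      (by rw [hCc]; exact g1) (by rw [hC]; exact g2)
    refine ⟨G, ?_⟩
    have h1' := conv _ _ h1
    have h2' := conv _ _ h2
    push_cast at h1'
    have h5 := frac_ineq (n : ℝ) b (by linarith) hb1'
    have h6 : (n : ℝ) / (b + 9 / 8) ≤ n / x :=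
      div_le_div_of_nonneg_left (by linarith) hx0 hx2
    linarith

end NGproof

namespace NGproof
open Finset

section lower
set_option linter.unusedSectionVars false
variable {V : Type*} [Fintype V] [DecidableEq V]

def IsModel (G : SimpleGraph V) (S : Finset V) (B : V → Finset V) (H : SimpleGraph V) : Prop :=
  (∀ x ∈ S, (G.induce ((B x : Finset V) : Set V)).Connected) ∧
  (∀ x ∈ S, ∀ y ∈ S, x ≠ y → Disjoint (B x) (B y)) ∧
  (∀ x y, H.Adj x y → x ∈ S ∧ y ∈ S ∧ ∃ u ∈ B x, ∃ v ∈ B y, G.Adj u v)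

noncomputable def ec (H : SimpleGraph V) : ℕ :=
  (univ.filter (fun p : V × V => H.Adj p.1 p.2)).card

noncomputable def nb (H : SimpleGraph V) (x : V) : Finset V := univ.filter (fun y => H.Adj x y)

lemma mem_nb {H : SimpleGraph V} {x y : V} : y ∈ nb H x ↔ H.Adj x y := by simp [nb]

lemma ec_eq (H : SimpleGraph V) : ec H = ∑ x, (nb H x).card := by
  unfold ec nb
  rw [← univ_product_univ, card_filter, sum_product]
  simp only [card_filter]

lemma ec_le (H : SimpleGraph V) : ec H ≤ Fintype.card V ^ 2 := by
  refine (card_le_univ _).trans ?_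
  simp [sq]

/-- contraction of `v` into `u` -/
def contr (H : SimpleGraph V) (u v : V) : SimpleGraph V where
  Adj x y := x ≠ y ∧ x ≠ v ∧ y ≠ v ∧ (H.Adj x y ∨ (x = u ∧ H.Adj v y) ∨ (y = u ∧ H.Adj v x))
  symm := ⟨fun x y h => ⟨h.1.symm, h.2.2.1, h.2.1, by
    rcases h.2.2.2 with h | h | h
    · exact Or.inl h.symm
    · exact Or.inr (Or.inr h)
    · exact Or.inr (Or.inl h)⟩⟩
  loopless := ⟨fun x h => h.1 rfl⟩

lemma ec_contr (H : SimpleGraph V) (u v : V) (huv : H.Adj u v) :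
    ec H ≤ ec (contr H u v) + 2 + 2 * (nb H u ∩ nb H v).card := by
  have hne : u ≠ v := huv.ne
  set A := nb H v \ (insert u (nb H u)) with hA
  have hA1 : (nb H v).card ≤ A.card + 1 + (nb H u ∩ nb H v).card := by
    have : nb H v ⊆ A ∪ insert u (nb H u ∩ nb H v) := by
      intro y hy
      simp only [hA, mem_union, mem_sdiff, mem_insert, mem_inter]
      tauto
    have h1 := (card_le_card this).trans (card_union_le _ _)
    have h2 := card_insert_le u (nb H u ∩ nb H v)
    omega
  set E0 := univ.filter (fun p : V × V => H.Adj p.1 p.2 ∧ p.1 ≠ v ∧ p.2 ≠ v) with hE0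
  have h1 : ec H ≤ E0.card + (nb H v).card + (nb H v).card := by
    have : univ.filter (fun p : V × V => H.Adj p.1 p.2) ⊆
        (E0 ∪ (nb H v).image (fun y => (v, y))) ∪ (nb H v).image (fun y => (y, v)) := by
      rintro ⟨x, y⟩ hxy
      simp only [mem_filter, mem_univ, true_and] at hxy
      simp only [hE0, mem_union, mem_filter, mem_univ, true_and, mem_image, mem_nb, Prod.mk.injEq]
      by_cases hx : x = v
      · subst hx
        exact Or.inl (Or.inr ⟨y, hxy, rfl, rfl⟩)
      · by_cases hy : y = v
        · subst hy
          exact Or.inr ⟨x, hxy.symm, rfl, rfl⟩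
        · exact Or.inl (Or.inl ⟨hxy, hx, hy⟩)
    have h1 := (card_le_card this).trans (card_union_le _ _)
    have h2 := card_union_le E0 ((nb H v).image (fun y => (v, y)))
    have h3 : ((nb H v).image (fun y => (v, y))).card ≤ _ := card_image_le
    have h4 : ((nb H v).image (fun y => (y, v))).card ≤ _ := card_image_le
    unfold ec
    omega
  have h2 : E0.card + A.card + A.card ≤ ec (contr H u v) := by
    have e1 : (A.image (fun y => (u, y))).card = A.card :=
      card_image_of_injective _ (fun a b h => (Prod.mk.inj h).2)
    have e2 : (A.image (fun y => (y, u))).card = A.card :=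
      card_image_of_injective _ (fun a b h => (Prod.mk.inj h).1)
    have d1 : Disjoint E0 (A.image (fun y => (u, y))) := by
      rw [Finset.disjoint_left]
      rintro ⟨x, y⟩ hx hy
      simp only [hE0, mem_filter, mem_univ, true_and] at hx
      simp only [mem_image, Prod.mk.injEq, hA, mem_sdiff, mem_insert, mem_nb] at hy
      obtain ⟨z, hz, rfl, rfl⟩ := hy
      tauto
    have d2 : Disjoint (E0 ∪ A.image (fun y => (u, y))) (A.image (fun y => (y, u))) := by
      rw [Finset.disjoint_left]
      rintro ⟨x, y⟩ hx hy
      simp only [mem_image, Prod.mk.injEq, hA, mem_sdiff, mem_insert, mem_nb] at hy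
      obtain ⟨z, hz, rfl, rfl⟩ := hy
      simp only [hE0, mem_union, mem_filter, mem_univ, true_and, mem_image, Prod.mk.injEq, hA,
        mem_sdiff, mem_insert, mem_nb] at hx
      rcases hx with hx | ⟨w, hw, h1, h2⟩
      · exact hz.2 (Or.inr hx.1.symm)
      · exact hz.2 (Or.inl h1.symm)
    rw [← e1, ← card_union_of_disjoint d1, e1, ← e2, ← card_union_of_disjoint d2]
    apply card_le_card
    rintro ⟨x, y⟩ hxy
    simp only [hE0, mem_union, mem_filter, mem_univ, true_and, mem_image, Prod.mk.injEq, hA,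
        mem_sdiff, mem_insert, mem_nb] at hxy
    simp only [mem_filter, mem_univ, true_and]
    rcases hxy with (h | ⟨w, hw, rfl, rfl⟩) | ⟨w, hw, rfl, rfl⟩
    · exact ⟨h.1.ne, h.2.1, h.2.2, Or.inl h.1⟩
    · exact ⟨fun h => hw.2 (Or.inl h.symm), hne, fun h => H.loopless.irrefl v (h ▸ hw.1),
        Or.inr (Or.inl ⟨rfl, hw.1⟩)⟩
    · exact ⟨fun h => hw.2 (Or.inl h), fun h => H.loopless.irrefl v (h ▸ hw.1), hne,
        Or.inr (Or.inr ⟨rfl, hw.1⟩)⟩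
  omega

lemma conn_union_adj {G : SimpleGraph V} {X Y : Finset V}
    (hX : (G.induce ((X : Finset V) : Set V)).Connected)
    (hY : (G.induce ((Y : Finset V) : Set V)).Connected) {x y : V} (hx : x ∈ X) (hy : y ∈ Y)
    (h : G.Adj x y) : (G.induce ((X ∪ Y : Finset V) : Set V)).Connected := by
  rw [coe_union]
  exact SimpleGraph.connected_induce_union hX.preconnected hY.preconnected hx hy h

lemma model_contr {G : SimpleGraph V} {S : Finset V} {B : V → Finset V} {H : SimpleGraph V}
    (hm : IsModel G S B H) {u v : V} (huv : H.Adj u v) :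
    IsModel G (S.erase v) (Function.update B u (B u ∪ B v)) (contr H u v) := by
  obtain ⟨hc, hd, ha⟩ := hm
  have hne : u ≠ v := huv.ne
  obtain ⟨hu, hv, a, hau, b, hbv, hab⟩ := ha u v huv
  refine ⟨?_, ?_, ?_⟩
  · intro x hx
    rw [mem_erase] at hx
    by_cases hxu : x = u
    · subst hxu
      rw [Function.update_self]
      exact conn_union_adj (hc x hu) (hc v hv) hau hbv hab
    · rw [Function.update_of_ne hxu]
      exact hc x hx.2
  · intro x hx y hy hxy
    rw [mem_erase] at hx hy
    by_cases hxu : x = u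
    · subst hxu
      rw [Function.update_self, Function.update_of_ne (Ne.symm hxy), disjoint_union_left]
      exact ⟨hd _ hu _ hy.2 hxy, hd _ hv _ hy.2 (Ne.symm hy.1)⟩
    · rw [Function.update_of_ne hxu]
      by_cases hyu : y = u
      · subst hyu
        rw [Function.update_self, disjoint_union_right]
        exact ⟨hd _ hx.2 _ hu hxy, hd _ hx.2 _ hv hx.1⟩
      · rw [Function.update_of_ne hyu]
        exact hd _ hx.2 _ hy.2 hxy
  · have hsub : ∀ z, B z ⊆ Function.update B u (B u ∪ B v) z := by
      intro z
      by_cases hz : z = u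
      · subst hz
        rw [Function.update_self]; exact subset_union_left
      · rw [Function.update_of_ne hz]
    have hsub2 : B v ⊆ Function.update B u (B u ∪ B v) u := by
      rw [Function.update_self]; exact subset_union_right
    rintro x y ⟨hxy, hxv, hyv, h | ⟨rfl, h⟩ | ⟨rfl, h⟩⟩
    · obtain ⟨h1, h2, p, hp, q, hq, hpq⟩ := ha x y h
      exact ⟨mem_erase.2 ⟨hxv, h1⟩, mem_erase.2 ⟨hyv, h2⟩, p, hsub _ hp, q, hsub _ hq, hpq⟩
    · obtain ⟨h1, h2, p, hp, q, hq, hpq⟩ := ha v y h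
      exact ⟨mem_erase.2 ⟨hxv, hu⟩, mem_erase.2 ⟨hyv, h2⟩, p, hsub2 hp, q, hsub _ hq, hpq⟩
    · obtain ⟨h1, h2, p, hp, q, hq, hpq⟩ := ha v x h
      exact ⟨mem_erase.2 ⟨hxv, h2⟩, mem_erase.2 ⟨hyv, hu⟩, q, hsub _ hq, p, hsub2 hp, hpq.symm⟩

lemma mader (G : SimpleGraph V) (k : ℕ) (hk : 1 ≤ k) [Nonempty V]
    (hG : 2 * k * Fintype.card V ≤ ec G) :
    ∃ (S : Finset V) (B : V → Finset V) (H : SimpleGraph V) (W : Finset V),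
      IsModel G S B H ∧ W ⊆ S ∧ W.Nonempty ∧ W.card ≤ 2 * k ∧
      ∀ x ∈ W, k ≤ (nb H x ∩ W).card := by
  let St : ℕ → Prop := fun N => ∃ (S : Finset V) (B : V → Finset V) (H : SimpleGraph V),
    IsModel G S B H ∧ S.Nonempty ∧ 2 * k * S.card ≤ ec H ∧
      S.card * (Fintype.card V ^ 2 + 1) + ec H = N
  have hex : ∃ N, St N := by
    refine ⟨_, univ, fun x => {x}, G, ⟨?_, ?_, ?_⟩, univ_nonempty, by simpa using hG, rfl⟩
    · intro x _
      rw [coe_singleton]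
      have : Nonempty (({x} : Set V) : Type _) := ⟨⟨x, rfl⟩⟩
      exact ⟨fun a b => by rw [Subsingleton.elim a b]⟩
    · intro x _ y _ h
      simpa using h
    · intro x y h
      exact ⟨mem_univ _, mem_univ _, x, by simp, y, by simp, h⟩
  obtain ⟨S, B, H, hm, hS, he, hN⟩ := Nat.find_spec hex
  have hmin : ∀ (S' : Finset V) (B' : V → Finset V) (H' : SimpleGraph V),
      IsModel G S' B' H' → S'.Nonempty → 2 * k * S'.card ≤ ec H' →
      S.card * (Fintype.card V ^ 2 + 1) + ec H ≤ S'.card * (Fintype.card V ^ 2 + 1) + ec H' := by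
    intro S' B' H' h1 h2 h3
    rw [hN]
    exact Nat.find_min' hex ⟨S', B', H', h1, h2, h3, rfl⟩
  have hSpos : 0 < S.card := hS.card_pos
  -- no isolated
  have hmin2 : ∀ (S' : Finset V) (B' : V → Finset V) (H' : SimpleGraph V),
      IsModel G S' B' H' → S'.Nonempty → S'.card + 1 = S.card → ec H' < 2 * k * S'.card := by
    intro S' B' H' h1 h2 h3
    by_contra hc
    push Not at hc
    have h4 := hmin S' B' H' h1 h2 hc
    have h5 := ec_le H'
    rw [← h3] at h4
    nlinarith
  have hecpos : 0 < ec H := lt_of_lt_of_le (by positivity) he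
  have hadj : ∃ x y, H.Adj x y := by
    obtain ⟨⟨x, y⟩, h⟩ := card_pos.1 hecpos
    exact ⟨x, y, (mem_filter.1 h).2⟩
  have hcontr : ∀ u v, H.Adj u v → k ≤ (nb H u ∩ nb H v).card := by
    intro u v huv
    obtain ⟨hu, hv, -⟩ := hm.2.2 u v huv
    have h1 := hmin2 _ _ _ (model_contr hm huv) ⟨u, mem_erase.2 ⟨huv.ne, hu⟩⟩
      (card_erase_add_one hv)
    have h2 := ec_contr H u v huv
    have h3 := card_erase_add_one hv
    rw [← h3] at he
    nlinarith
  have hiso : ∀ x ∈ S, 0 < (nb H x).card := by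
    intro x hx
    by_contra hc
    have hc0 : nb H x = ∅ := card_eq_zero.1 (by omega)
    have hxn : ∀ y, ¬ H.Adj x y := fun y hy => by
      have := mem_nb.2 hy
      rw [hc0] at this
      simp at this
    have hmod : IsModel G (S.erase x) B H := by
      refine ⟨fun y hy => hm.1 y (mem_of_mem_erase hy), fun y hy z hz => 
        hm.2.1 y (mem_of_mem_erase hy) z (mem_of_mem_erase hz), fun y z hyz => ?_⟩
      obtain ⟨h1, h2, h3⟩ := hm.2.2 y z hyz
      exact ⟨mem_erase.2 ⟨fun h => hxn z (h ▸ hyz), h1⟩,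
        mem_erase.2 ⟨fun h => hxn y (h ▸ hyz.symm), h2⟩, h3⟩
    obtain ⟨y, z, hyz⟩ := hadj
    have h1 := hmin2 _ _ _ hmod ⟨y, mem_erase.2 ⟨fun h => hxn z (h ▸ hyz), (hm.2.2 y z hyz).1⟩⟩
      (card_erase_add_one hx)
    have h3 := card_erase_add_one hx
    rw [← h3] at he
    nlinarith
  have hup : ec H ≤ 2 * k * S.card + 1 := by
    obtain ⟨x, y, hxy⟩ := hadj
    obtain ⟨H', hH'⟩ : ∃ H' : SimpleGraph V, H' = H.deleteEdges {s(x, y)} := ⟨_, rfl⟩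
    have hle : H' ≤ H := hH' ▸ SimpleGraph.deleteEdges_le _
    have hmod : IsModel G S B H' := ⟨hm.1, hm.2.1, fun a b h => hm.2.2 a b (hle h)⟩
    have hlt : ec H' < ec H := by
      apply card_lt_card
      rw [ssubset_iff_of_subset]
      · exact ⟨(x, y), by simpa using hxy, by simp [hH']⟩
      · intro p hp
        simp only [mem_filter, mem_univ, true_and] at hp ⊢
        exact hle hp
    have hge : ec H ≤ ec H' + 2 := by
      have : univ.filter (fun p : V × V => H.Adj p.1 p.2) ⊆
          univ.filter (fun p : V × V => H'.Adj p.1 p.2) ∪ {(x, y), (y, x)} := by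
        rintro ⟨a, b⟩ hp
        simp only [mem_filter, mem_univ, true_and, mem_union, mem_insert, mem_singleton, hH',
          SimpleGraph.deleteEdges_adj, Set.mem_singleton_iff, Sym2.eq_iff, Prod.mk.injEq] at hp ⊢
        tauto
      have h1 := (card_le_card this).trans (card_union_le _ _)
      have h2 : ({(x, y), (y, x)} : Finset (V × V)).card ≤ 2 := card_le_two
      unfold ec
      omega
    by_contra hc
    push Not at hc
    have := hmin S B H' hmod hS (by omega)
    omega
  -- low degree vertex
  have hlow : ∃ v ∈ S, (nb H v).card ≤ 2 * k := by
    by_contra hc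
    push Not at hc
    have h1 : ∑ x ∈ S, (2 * k + 1) ≤ ∑ x ∈ S, (nb H x).card := sum_le_sum (fun x hx => hc x hx)
    have h2 : ∑ x ∈ S, (nb H x).card ≤ ec H := by
      rw [ec_eq]
      exact sum_le_sum_of_subset (subset_univ _)
    rw [sum_const, smul_eq_mul] at h1
    -- |S| ≥ 2
    obtain ⟨x, y, hxy⟩ := hadj
    obtain ⟨hx, hy, -⟩ := hm.2.2 x y hxy
    have h3 : 1 < S.card := one_lt_card.2 ⟨x, hx, y, hy, hxy.ne⟩
    nlinarith
  obtain ⟨v, hv, hvk⟩ := hlow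
  refine ⟨S, B, H, nb H v, hm, ?_, card_pos.1 (hiso v hv), hvk, ?_⟩
  · intro y hy
    exact (hm.2.2 v y (mem_nb.1 hy)).2.1
  · intro x hx
    exact hcontr x v (mem_nb.1 hx).symm

end lower
end NGproof

namespace NGproof
open Finset

section lower2
set_option linter.unusedSectionVars false
variable {V : Type*} [Fintype V] [DecidableEq V]

def Rob (H : SimpleGraph V) (W : Finset V) (k : ℕ) : Prop :=
  ∀ U : Finset V, 10 * U.card ≤ k → ∀ P ⊆ W \ U, P.Nonempty → ((W \ U) \ P).Nonempty →
    ∃ x ∈ P, ∃ y ∈ (W \ U) \ P, H.Adj x y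

lemma deg_sdiff {H : SimpleGraph V} {W U P : Finset V} {x : V}
    (h : ∀ y ∈ (W \ U) \ P, ¬ H.Adj x y) :
    (nb H x ∩ W).card ≤ (nb H x ∩ P).card + U.card := by
  have : nb H x ∩ W ⊆ (nb H x ∩ P) ∪ U := by
    intro y hy
    simp only [mem_inter, mem_union, mem_nb, mem_sdiff] at *
    have := h y
    tauto
  exact (card_le_card this).trans (card_union_le _ _)

lemma rob_small {H : SimpleGraph V} {W : Finset V} {k : ℕ} (hk : 1 ≤ k) (hW : W.card ≤ k)
    (hd : ∀ x ∈ W, 9 * k ≤ 10 * (nb H x ∩ W).card) : Rob H W k := by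
  intro U hU P hP ⟨x, hx⟩ ⟨y, hy⟩
  by_contra hc
  push Not at hc
  have h1 := deg_sdiff (H := H) (W := W) (U := U) (P := P) (x := x) (fun z hz => hc x hx z hz)
  have h2 := deg_sdiff (H := H) (W := W) (U := U) (P := (W \ U) \ P) (x := y) (fun z hz h => by
    simp only [mem_sdiff, not_and, not_not] at hz
    exact hc z (hz.2 hz.1) y hy h.symm)
  have hxW := hd x (mem_sdiff.1 (hP hx)).1
  have hyW := hd y (mem_sdiff.1 (mem_sdiff.1 hy).1).1
  have h3 : (nb H x ∩ P).card ≤ P.card := card_le_card inter_subset_right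
  have h4 : (nb H y ∩ ((W \ U) \ P)).card ≤ ((W \ U) \ P).card := card_le_card inter_subset_right
  have h5 := card_sdiff_add_card_eq_card hP
  have h6 : (W \ U).card ≤ W.card := card_le_card sdiff_subset
  omega

lemma rob_exists {H : SimpleGraph V} {W : Finset V} {k : ℕ} (hk : 1 ≤ k) (hne : W.Nonempty)
    (hW : W.card ≤ 2 * k) (hd : ∀ x ∈ W, k ≤ (nb H x ∩ W).card) :
    ∃ W' ⊆ W, W'.Nonempty ∧ W'.card ≤ 2 * k ∧ (∀ x ∈ W', 9 * k ≤ 10 * (nb H x ∩ W').card) ∧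
      Rob H W' k := by
  by_cases hr : Rob H W k
  · exact ⟨W, Subset.rfl, hne, hW, fun x hx => by have := hd x hx; omega, hr⟩
  unfold Rob at hr
  push Not at hr
  obtain ⟨U, hU, P, hP, hPn, hQn, hc⟩ := hr
  have h5 := card_sdiff_add_card_eq_card hP
  have h6 : (W \ U).card ≤ W.card := card_le_card sdiff_subset
  have hPd : ∀ x ∈ P, 9 * k ≤ 10 * (nb H x ∩ P).card := by
    intro x hx
    have h1 := deg_sdiff (H := H) (W := W) (U := U) (P := P) (x := x) (fun z hz => hc x hx z hz)
    have := hd x (mem_sdiff.1 (hP hx)).1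
    omega
  have hQd : ∀ y ∈ (W \ U) \ P, 9 * k ≤ 10 * (nb H y ∩ ((W \ U) \ P)).card := by
    intro y hy
    have h2 := deg_sdiff (H := H) (W := W) (U := U) (P := (W \ U) \ P) (x := y) (fun z hz h => by
      simp only [mem_sdiff, not_and, not_not] at hz
      exact hc z (hz.2 hz.1) y hy h.symm)
    have := hd y (mem_sdiff.1 (mem_sdiff.1 hy).1).1
    omega
  by_cases hs : P.card ≤ k
  · exact ⟨P, hP.trans sdiff_subset, hPn, by omega, hPd, rob_small hk hs hPd⟩
  · exact ⟨(W \ U) \ P, sdiff_subset.trans sdiff_subset, hQn, by omega, hQd,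
      rob_small hk (by omega) hQd⟩

def Good (G : SimpleGraph V) (B : V → Finset V) (C : Finset V) : Prop :=
  (G.induce ((C.biUnion B : Finset V) : Set V)).Connected

variable {G : SimpleGraph V} {S : Finset V} {B : V → Finset V} {H : SimpleGraph V}

lemma good_single (hm : IsModel G S B H) {x : V} (hx : x ∈ S) : Good G B {x} := by
  unfold Good
  rw [singleton_biUnion]
  exact hm.1 x hx

lemma good_adj (hm : IsModel G S B H) {C D : Finset V} (hC : Good G B C) (hD : Good G B D)
    {x y : V} (hx : x ∈ C) (hy : y ∈ D) (h : H.Adj x y) : Good G B (C ∪ D) := by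
  obtain ⟨-, -, u, hu, v, hv, huv⟩ := hm.2.2 x y h
  unfold Good
  rw [union_biUnion]
  exact conn_union_adj hC hD (mem_biUnion.2 ⟨x, hx, hu⟩) (mem_biUnion.2 ⟨y, hy, hv⟩) huv

lemma good_insert (hm : IsModel G S B H) {C : Finset V} (hC : Good G B C)
    {x y : V} (hx : x ∈ C) (h : H.Adj x y) : Good G B (insert y C) := by
  have := good_adj hm hC (good_single hm (hm.2.2 x y h).2.1) hx (mem_singleton_self y) h
  rwa [union_comm, ← insert_eq] at this

lemma star (hm : IsModel G S B H) {Y : Finset V} {a : V} (haY : a ∈ Y) (haS : a ∈ S)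
    (T : Finset V) (hT : T ⊆ Y) (hD : ∀ x ∈ T, ∃ c ∈ Y, H.Adj a c ∧ H.Adj c x) :
    ∃ C : Finset V, a ∈ C ∧ T ⊆ C ∧ C ⊆ Y ∧ Good G B C ∧ C.card ≤ 2 * T.card + 1 := by
  induction T using Finset.induction_on with
  | empty => exact ⟨{a}, by simp, by simp, by simpa using haY, good_single hm haS, by simp⟩
  | insert x T hx ih =>
    obtain ⟨C, h1, h2, h3, h4, h5⟩ := ih ((subset_insert _ _).trans hT)
      (fun z hz => hD z (mem_insert_of_mem hz))
    obtain ⟨c, hcY, hac, hcx⟩ := hD x (mem_insert_self _ _)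
    refine ⟨insert x (insert c C), by simp [h1], ?_, ?_, ?_, ?_⟩
    · exact insert_subset_insert _ (h2.trans (subset_insert _ _))
    · exact insert_subset (hT (mem_insert_self _ _)) (insert_subset hcY h3)
    · exact good_insert hm (good_insert hm h4 h1 hac) (mem_insert_self _ _) hcx
    · have e1 := card_insert_le x (insert c C)
      have e2 := card_insert_le c C
      rw [card_insert_of_notMem hx]
      omega

lemma deg_Y {W U : Finset V} {x : V} : 
    (nb H x ∩ W).card ≤ (nb H x ∩ (W \ U)).card + U.card :=
  deg_sdiff (P := W \ U) (fun y hy => by simp at hy)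

lemma connector (hm : IsModel G S B H) {W U : Finset V} {k : ℕ} (hk : 1 ≤ k) (hWS : W ⊆ S)
    (hW : W.card ≤ 2 * k) (hd : ∀ x ∈ W, 9 * k ≤ 10 * (nb H x ∩ W).card) (hR : Rob H W k)
    (hU : 10 * U.card ≤ k) (T : Finset V) (hT : T ⊆ W \ U) (hTn : T.Nonempty) :
    ∃ C : Finset V, T ⊆ C ∧ C ⊆ W \ U ∧ Good G B C ∧ C.card ≤ 2 * T.card + 6 := by
  obtain ⟨a, haT⟩ := hTn
  have haY := hT haT
  have hYW : W \ U ⊆ W := sdiff_subset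
  have hdY : ∀ x ∈ W \ U, 8 * k ≤ 10 * (nb H x ∩ (W \ U)).card := by
    intro x hx
    have h1 := hd x (hYW hx)
    have h2 := deg_Y (H := H) (W := W) (U := U) (x := x)
    omega
  generalize hY : W \ U = Y at *
  have hYc : Y.card ≤ 2 * k := (card_le_card hYW).trans hW
  set P := Y.filter (fun x => ∃ c ∈ Y, H.Adj a c ∧ H.Adj c x) with hPdef
  by_cases hP : Y ⊆ P
  · obtain ⟨C, h1, h2, h3, h4, h5⟩ := star hm haY (hWS (hYW haY)) T hT
      (fun x hx => (mem_filter.1 (hP (hT hx))).2)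
    exact ⟨C, h2, h3, h4, by omega⟩
  obtain ⟨b, hbY, hbP⟩ := not_subset.1 hP
  have hdisj : ∀ p q, (¬ ∃ c ∈ Y, H.Adj p c ∧ H.Adj c q) → 
      Disjoint (nb H p ∩ Y) (nb H q ∩ Y) := by
    intro p q h
    rw [Finset.disjoint_left]
    intro c hc hc'
    rw [mem_inter, mem_nb] at hc hc'
    exact h ⟨c, hc.2, hc.1, hc'.1.symm⟩
  have hnP : ∀ y ∈ Y, y ∉ P → ¬ ∃ c ∈ Y, H.Adj a c ∧ H.Adj c y := by
    intro y hy h1 h2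
    exact h1 (mem_filter.2 ⟨hy, h2⟩)
  have hb : ∀ y ∈ Y, y ∉ P → ∃ c ∈ Y, H.Adj b c ∧ H.Adj c y := by
    intro y hy hyP
    by_contra hc
    have d1 := hdisj a b (hnP b hbY hbP)
    have d2 := hdisj a y (hnP y hy hyP)
    have d3 := hdisj b y hc
    have e1 := card_union_of_disjoint d1
    have e2 := card_union_of_disjoint (disjoint_union_left.2 ⟨d2, d3⟩)
    have e3 : ((nb H a ∩ Y ∪ nb H b ∩ Y) ∪ nb H y ∩ Y).card ≤ Y.card :=
      card_le_card (union_subset (union_subset inter_subset_right inter_subset_right)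
        inter_subset_right)
    have f1 := hdY a haY
    have f2 := hdY b hbY
    have f3 := hdY y hy
    omega
  have haP : a ∈ P := by
    have h1 := hdY a haY
    have : 0 < (nb H a ∩ Y).card := by omega
    obtain ⟨c, hc⟩ := card_pos.1 this
    rw [mem_inter, mem_nb] at hc
    exact mem_filter.2 ⟨haY, c, hc.2, hc.1, hc.1.symm⟩
  obtain ⟨x, hx, y, hy, hxy⟩ := hR U hU P (by rw [hY]; exact filter_subset _ _) ⟨a, haP⟩
    ⟨b, by rw [hY]; exact mem_sdiff.2 ⟨hbY, hbP⟩⟩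
  rw [hY, mem_sdiff] at hy
  have hPY : P ⊆ Y := filter_subset _ _
  obtain ⟨C, h1, h2, h3, h4, h5⟩ := star hm haY (hWS (hYW haY)) (insert x (T ∩ P))
    (insert_subset (hPY hx) (inter_subset_left.trans hT))
    (fun z hz => by
      rcases mem_insert.1 hz with rfl | hz
      · exact (mem_filter.1 hx).2
      · exact (mem_filter.1 (mem_inter.1 hz).2).2)
  obtain ⟨C', h1', h2', h3', h4', h5'⟩ := star hm hbY (hWS (hYW hbY)) (insert y (T \ P))
    (insert_subset hy.1 (sdiff_subset.trans hT))
    (fun z hz => by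
      rcases mem_insert.1 hz with rfl | hz
      · exact hb _ hy.1 hy.2
      · exact hb _ (hT (mem_sdiff.1 hz).1) (mem_sdiff.1 hz).2)
  refine ⟨C ∪ C', ?_, union_subset h3 h3', good_adj hm h4 h4' (h2 (mem_insert_self _ _))
    (h2' (mem_insert_self _ _)) hxy, ?_⟩
  · intro z hz
    by_cases hzP : z ∈ P
    · exact mem_union_left _ (h2 (mem_insert_of_mem (mem_inter.2 ⟨hz, hzP⟩)))
    · exact mem_union_right _ (h2' (mem_insert_of_mem (mem_sdiff.2 ⟨hz, hzP⟩)))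
  · have e1 := card_insert_le x (T ∩ P)
    have e2 := card_insert_le y (T \ P)
    have e3 := card_union_le C C'
    have e4 := card_inter_add_card_sdiff T P
    omega

end lower2
end NGproof

namespace NGproof
open Finset

section lower3
set_option linter.unusedSectionVars false
variable {V : Type*} [Fintype V] [DecidableEq V]

noncomputable def nn (H : SimpleGraph V) (W C : Finset V) : Finset V :=
  W.filter (fun x => ∀ c ∈ C, ¬ H.Adj x c)

lemma mem_nn {H : SimpleGraph V} {W C : Finset V} {x : V} :
    x ∈ nn H W C ↔ x ∈ W ∧ ∀ c ∈ C, ¬ H.Adj x c := by simp [nn]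

lemma tuple_exists {H : SimpleGraph V} {W Y : Finset V} (hWn : W.Nonempty) (hYn : Y.Nonempty)
    (s i t : ℕ) (hit : i ≤ t) (D : ℕ → Finset V)
    (hD : ∀ j < i, ((D j).card : ℝ) ≤ 4 * W.card * (3 / 5 : ℝ) ^ s)
    (hdeg : ∀ x ∈ W, ((Y \ nb H x).card : ℝ) ≤ 3 / 5 * Y.card)
    (hWY : (W.card : ℝ) ≤ 5 / 4 * Y.card)
    (hnum : 4 * (t : ℝ) * 5 ^ s * (3 / 5 : ℝ) ^ (s * s) ≤ 1) :
    ∃ f : Fin s → V, (∀ a, f a ∈ Y) ∧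
      ((nn H W (univ.image f)).card : ℝ) ≤ 4 * W.card * (3 / 5 : ℝ) ^ s ∧
      ∀ j < i, ∃ a, f a ∉ D j := by
  set μ : ℝ := 4 * W.card * (3 / 5 : ℝ) ^ s with hμ
  have hWpos : (0 : ℝ) < W.card := by exact_mod_cast hWn.card_pos
  have hYpos : (0 : ℝ) < Y.card := by exact_mod_cast hYn.card_pos
  have hμpos : 0 < μ := by positivity
  set A : Finset (Fin s → V) := Fintype.piFinset (fun _ : Fin s => Y) with hA
  have hAc : (A.card : ℝ) = (Y.card : ℝ) ^ s := by
    rw [hA, Fintype.card_piFinset_const]; push_cast; rfl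
  set X1 := A.filter (fun f => μ < ((nn H W (univ.image f)).card : ℝ)) with hX1
  set X2 := (range i).biUnion (fun j => Fintype.piFinset (fun _ : Fin s => D j)) with hX2
  have h1 : (X1.card : ℝ) * μ ≤ W.card * (3 / 5 * Y.card : ℝ) ^ s := by
    have e1 : (X1.card : ℝ) * μ ≤ ∑ f ∈ A, ((nn H W (univ.image f)).card : ℝ) := by
      rw [← nsmul_eq_mul, ← sum_const]
      refine (sum_le_sum (fun f hf => (mem_filter.1 hf).2.le)).trans ?_
      exact sum_le_sum_of_subset_of_nonneg (filter_subset _ _) (fun _ _ _ => by positivity)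
    have e2 : ∑ f ∈ A, (nn H W (univ.image f)).card =
        ∑ x ∈ W, (A.filter (fun f => ∀ c ∈ univ.image f, ¬ H.Adj x c)).card := by
      unfold nn
      simp only [card_filter]
      rw [sum_comm]
    have e3 : ∀ x ∈ W, ((A.filter (fun f => ∀ c ∈ univ.image f, ¬ H.Adj x c)).card : ℝ) ≤
        (3 / 5 * Y.card : ℝ) ^ s := by
      intro x hx
      have : A.filter (fun f => ∀ c ∈ univ.image f, ¬ H.Adj x c) ⊆
          Fintype.piFinset (fun _ : Fin s => Y \ nb H x) := by
        intro f hf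
        rw [mem_filter, hA, Fintype.mem_piFinset] at hf
        rw [Fintype.mem_piFinset]
        intro a
        rw [mem_sdiff, mem_nb]
        exact ⟨hf.1 a, hf.2 _ (mem_image_of_mem _ (mem_univ a))⟩
      have h := card_le_card this
      rw [Fintype.card_piFinset_const] at h
      calc ((A.filter (fun f => ∀ c ∈ univ.image f, ¬ H.Adj x c)).card : ℝ)
          ≤ ((Y \ nb H x).card : ℝ) ^ s := by exact_mod_cast (by simpa using h)
        _ ≤ _ := pow_le_pow_left₀ (by positivity) (hdeg x hx) s
    refine e1.trans ?_
    rw [← Nat.cast_sum, e2, Nat.cast_sum]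
    refine (sum_le_sum e3).trans ?_
    rw [sum_const, nsmul_eq_mul]
  have h1' : (X1.card : ℝ) * 4 ≤ (Y.card : ℝ) ^ s := by
    have : (W.card : ℝ) * (3 / 5 * Y.card : ℝ) ^ s = μ / 4 * (Y.card : ℝ) ^ s := by
      rw [hμ, mul_pow]; ring
    rw [this] at h1
    have : (X1.card : ℝ) * 4 * μ ≤ (Y.card : ℝ) ^ s * μ := by linarith
    exact le_of_mul_le_mul_right this hμpos
  have h2 : (X2.card : ℝ) ≤ t * μ ^ s := by
    have e1 : (X2.card : ℝ) ≤ ∑ j ∈ range i, ((D j).card : ℝ) ^ s := by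
      have := card_biUnion_le (s := range i) (t := fun j => Fintype.piFinset (fun _ : Fin s => D j))
      simp only [Fintype.card_piFinset_const] at this
      exact_mod_cast (by simpa using this)
    have e2 : ∑ j ∈ range i, ((D j).card : ℝ) ^ s ≤ ∑ j ∈ range i, μ ^ s :=
      sum_le_sum (fun j hj => pow_le_pow_left₀ (by positivity) (hD j (mem_range.1 hj)) s)
    rw [sum_const, card_range, nsmul_eq_mul] at e2
    have e3 : (i : ℝ) * μ ^ s ≤ t * μ ^ s := by
      have : (i : ℝ) ≤ t := by exact_mod_cast hit
      gcongr
    linarith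
  have h2' : (X2.card : ℝ) * 4 ≤ (Y.card : ℝ) ^ s := by
    have e1 : μ ≤ 5 * (3 / 5 : ℝ) ^ s * Y.card := by
      rw [hμ]
      have : (0 : ℝ) < (3 / 5 : ℝ) ^ s := by positivity
      nlinarith
    have e2 : μ ^ s ≤ 5 ^ s * (3 / 5 : ℝ) ^ (s * s) * (Y.card : ℝ) ^ s := by
      refine (pow_le_pow_left₀ hμpos.le e1 s).trans (le_of_eq ?_)
      rw [mul_pow, mul_pow, ← pow_mul]
    have e3 : (t : ℝ) * μ ^ s ≤ t * (5 ^ s * (3 / 5 : ℝ) ^ (s * s) * (Y.card : ℝ) ^ s) := by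
      gcongr
    have e4 : (4 * (t : ℝ) * 5 ^ s * (3 / 5 : ℝ) ^ (s * s)) * (Y.card : ℝ) ^ s ≤
        1 * (Y.card : ℝ) ^ s := by gcongr
    nlinarith
  have hlt : (X1 ∪ X2).card < A.card := by
    have e1 : ((X1 ∪ X2).card : ℝ) ≤ X1.card + X2.card := by exact_mod_cast card_union_le _ _
    have e2 : (0 : ℝ) < (Y.card : ℝ) ^ s := by positivity
    have : ((X1 ∪ X2).card : ℝ) < A.card := by rw [hAc]; linarith
    exact_mod_cast this
  obtain ⟨f, hfA, hf⟩ := exists_mem_notMem_of_card_lt_card hlt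
  rw [mem_union, not_or] at hf
  refine ⟨f, Fintype.mem_piFinset.1 hfA, ?_, ?_⟩
  · by_contra hc
    push Not at hc
    exact hf.1 (mem_filter.2 ⟨hfA, hc⟩)
  · intro j hj
    by_contra hc
    push Not at hc
    exact hf.2 (mem_biUnion.2 ⟨j, mem_range.2 hj, Fintype.mem_piFinset.2 hc⟩)

lemma greedy {G : SimpleGraph V} {S : Finset V} {B : V → Finset V} {H : SimpleGraph V}
    (hm : IsModel G S B H) {W : Finset V} {k : ℕ} (hk : 1 ≤ k) (hWS : W ⊆ S) (hWn : W.Nonempty)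
    (hW : W.card ≤ 2 * k) (hd : ∀ x ∈ W, 9 * k ≤ 10 * (nb H x ∩ W).card) (hR : Rob H W k)
    (s t : ℕ) (hs : 1 ≤ s) (hts : 10 * (t * (2 * s + 6)) ≤ k)
    (hnum : 4 * (t : ℝ) * 5 ^ s * (3 / 5 : ℝ) ^ (s * s) ≤ 1) :
    ∀ i ≤ t, ∃ C : ℕ → Finset V, (∀ j < i, C j ⊆ W ∧ Good G B (C j) ∧ (C j).card ≤ 2 * s + 6 ∧
        ((nn H W (C j)).card : ℝ) ≤ 4 * W.card * (3 / 5 : ℝ) ^ s) ∧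
      (∀ j < i, ∀ l < j, Disjoint (C j) (C l) ∧ ∃ x ∈ C j, ∃ y ∈ C l, H.Adj x y) := by
  intro i
  induction i with
  | zero => exact fun _ => ⟨fun _ => ∅, by simp, by simp⟩
  | succ i ih =>
    intro hi
    obtain ⟨C, hC1, hC2⟩ := ih (by omega)
    set U := (range i).biUnion C with hUdef
    have hU : 10 * U.card ≤ k := by
      have h1 : U.card ≤ (range i).card * (2 * s + 6) :=
        card_biUnion_le_card_mul _ _ _ (fun j hj => (hC1 j (mem_range.1 hj)).2.2.1)
      rw [card_range] at h1
      have : i * (2 * s + 6) ≤ t * (2 * s + 6) := Nat.mul_le_mul_right _ (by omega)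
      omega
    obtain ⟨w, hw⟩ := hWn
    have hWU : W.card ≤ (W \ U).card + U.card := by
      have : W ⊆ (W \ U) ∪ U := by intro z hz; simp [hz]
      exact (card_le_card this).trans (card_union_le _ _)
    have hWlow : 9 * k ≤ 10 * W.card := (hd w hw).trans
      (Nat.mul_le_mul_left _ (card_le_card inter_subset_right))
    have hYn : (W \ U).Nonempty := card_pos.1 (by omega)
    have hdeg : ∀ x ∈ W, (((W \ U) \ nb H x).card : ℝ) ≤ 3 / 5 * (W \ U).card := by
      intro x hx
      have h1 := hd x hx
      have h2 := deg_Y (H := H) (W := W) (U := U) (x := x)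
      have h3 := card_inter_add_card_sdiff (W \ U) (nb H x)
      rw [inter_comm] at h3
      have h4 : (W \ U).card ≤ W.card := card_le_card sdiff_subset
      have : 5 * ((W \ U) \ nb H x).card ≤ 3 * (W \ U).card := by omega
      have h5 : (5 : ℝ) * ((W \ U) \ nb H x).card ≤ 3 * (W \ U).card := by exact_mod_cast this
      linarith
    have hWY : (W.card : ℝ) ≤ 5 / 4 * (W \ U).card := by
      have : 4 * W.card ≤ 5 * (W \ U).card := by omega
      have h5 : (4 : ℝ) * W.card ≤ 5 * (W \ U).card := by exact_mod_cast this
      linarith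
    obtain ⟨f, hfY, hfn, hfD⟩ := tuple_exists (H := H) ⟨w, hw⟩ hYn s i t (by omega)
      (fun j => nn H W (C j)) (fun j hj => (hC1 j hj).2.2.2) hdeg hWY hnum
    obtain ⟨E, hE1, hE2, hE3, hE4⟩ := connector hm hk hWS hW hd hR hU (univ.image f)
      (by intro z hz; obtain ⟨a, -, rfl⟩ := mem_image.1 hz; exact hfY a)
      ⟨f ⟨0, hs⟩, mem_image_of_mem _ (mem_univ _)⟩
    have hcs : (univ.image f).card ≤ s := card_image_le.trans (by simp)
    refine ⟨fun j => if j = i then E else C j, ?_, ?_⟩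
    · intro j hj
      by_cases hji : j = i
      · simp only [hji, if_true]
        refine ⟨hE2.trans sdiff_subset, hE3, by omega, le_trans ?_ hfn⟩
        norm_cast
        apply card_le_card
        intro z hz
        rw [mem_nn] at hz ⊢
        exact ⟨hz.1, fun c hc => hz.2 c (hE1 hc)⟩
      · simp only [hji, if_false]
        exact hC1 j (by omega)
    · intro j hj l hl
      have hli : l ≠ i := by omega
      simp only [hli, if_false]
      by_cases hji : j = i
      · simp only [hji, if_true]
        constructor
        · rw [Finset.disjoint_left]
          intro z hz hz'
          exact (mem_sdiff.1 (hE2 hz)).2 (mem_biUnion.2 ⟨l, mem_range.2 (by omega), hz'⟩)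
        · obtain ⟨a, ha⟩ := hfD l (by omega)
          rw [mem_nn] at ha
          push Not at ha
          obtain ⟨c, hc, hac⟩ := ha (mem_sdiff.1 (hfY a)).1
          exact ⟨f a, hE1 (mem_image_of_mem _ (mem_univ _)), c, hc, hac⟩
      · simp only [hji, if_false]
        exact hC2 j (by omega) l hl

end lower3

lemma minor_of_ec {n : ℕ} (G : SimpleGraph (Fin n)) (k s t : ℕ) (hn : 1 ≤ n) (hk : 1 ≤ k)
    (hG : 2 * k * n ≤ ec G) (hs : 1 ≤ s) (hts : 10 * (t * (2 * s + 6)) ≤ k)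
    (hnum : 4 * (t : ℝ) * 5 ^ s * (3 / 5 : ℝ) ^ (s * s) ≤ 1) : NG.HasCliqueMinor G t := by
  have : Nonempty (Fin n) := ⟨⟨0, hn⟩⟩
  obtain ⟨S, B, H, W0, hm, hWS, hWn, hWc, hd⟩ := mader G k hk (by simpa using hG)
  obtain ⟨W, hW0, hWn', hWc', hd', hR⟩ := rob_exists hk hWn hWc hd
  have hS : W ⊆ S := hW0.trans hWS
  obtain ⟨C, hC1, hC2⟩ := greedy hm hk hS hWn' hWc' hd' hR s t hs hts hnum t le_rfl
  have key : ∀ p q : Fin t, q < p → Disjoint ((C p).biUnion B) ((C q).biUnion B) ∧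
      ∃ u ∈ (C p).biUnion B, ∃ v ∈ (C q).biUnion B, G.Adj u v := by
    intro p q hqp
    obtain ⟨h1, x, hx, y, hy, hxy⟩ := hC2 p p.2 q hqp
    constructor
    · rw [Finset.disjoint_left]
      intro z hz hz'
      obtain ⟨a, ha, hza⟩ := mem_biUnion.1 hz
      obtain ⟨b, hb, hzb⟩ := mem_biUnion.1 hz'
      have hab : a ≠ b := fun h => Finset.disjoint_left.1 h1 ha (h ▸ hb)
      exact Finset.disjoint_left.1
        (hm.2.1 a (hS ((hC1 p p.2).1 ha)) b (hS ((hC1 q q.2).1 hb)) hab) hza hzb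
    · obtain ⟨-, -, u, hu, v, hv, huv⟩ := hm.2.2 x y hxy
      exact ⟨u, mem_biUnion.2 ⟨x, hx, hu⟩, v, mem_biUnion.2 ⟨y, hy, hv⟩, huv⟩
  have hgood : ∀ p : Fin t, (G.induce (((C p).biUnion B : Finset (Fin n)) : Set (Fin n))).Connected :=
    fun p => (hC1 p p.2).2.1
  refine ⟨fun p => (C p).biUnion B, ?_, ?_, ?_, ?_⟩
  · intro p
    obtain ⟨⟨z, hz⟩⟩ := (hgood p).nonempty
    exact ⟨z, by simpa using hz⟩
  · intro p
    convert hgood p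
  · intro p q hpq
    rcases lt_or_gt_of_ne hpq with h | h
    · exact (key q p h).1.symm
    · exact (key p q h).1
  · intro p q hpq
    rcases lt_or_gt_of_ne hpq with h | h
    · obtain ⟨u, hu, v, hv, huv⟩ := (key q p h).2
      exact ⟨v, hv, u, hu, huv.symm⟩
    · exact (key p q h).2

end NGproof

namespace NGproof
open Finset

lemma exists_dense {n r : ℕ} (hr : 2 ≤ r) (hn : 1 ≤ n) (G : Fin r → SimpleGraph (Fin n))
    (hG : NG.IsDecomp G) : ∃ i, 2 * ((n - 1) / (2 * r)) * n ≤ ec (G i) := by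
  by_contra hc
  push Not at hc
  have h1 : n * (n - 1) ≤ ∑ i, ec (G i) := by
    have e1 : ((univ : Finset (Fin n)).offDiag).card = n * (n - 1) := by
      rw [offDiag_card, card_univ, Fintype.card_fin, Nat.mul_sub_one]
    rw [← e1]
    have : (univ : Finset (Fin n)).offDiag ⊆ (univ : Finset (Fin r)).biUnion
        (fun i => univ.filter (fun p : Fin n × Fin n => (G i).Adj p.1 p.2)) := by
      rintro ⟨x, y⟩ hxy
      have hne : x ≠ y := (mem_offDiag.1 hxy).2.2
      have : (⨆ i, G i).Adj x y := by rw [hG.2]; exact hne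
      rw [SimpleGraph.iSup_adj] at this
      obtain ⟨i, hi⟩ := this
      exact mem_biUnion.2 ⟨i, mem_univ _, mem_filter.2 ⟨mem_univ _, hi⟩⟩
    exact (card_le_card this).trans card_biUnion_le
  have hne : (univ : Finset (Fin r)).Nonempty := ⟨⟨0, by omega⟩, mem_univ _⟩
  have h2 : ∑ i, ec (G i) < ∑ _i : Fin r, 2 * ((n - 1) / (2 * r)) * n :=
    sum_lt_sum_of_nonempty hne (fun i _ => hc i)
  rw [sum_const, card_univ, Fintype.card_fin, smul_eq_mul] at h2
  have h3 : 2 * r * ((n - 1) / (2 * r)) ≤ n - 1 := Nat.mul_div_le _ _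
  have h4 := Nat.mul_le_mul_left n h3
  have h5 : r * (2 * ((n - 1) / (2 * r)) * n) = n * (2 * r * ((n - 1) / (2 * r))) := by ring
  omega

lemma num_lem {n s t : ℕ} (hn : 4 ≤ n) (hs : 11 ≤ s) (ht : t ≤ n)
    (hsL : 4 * Real.logb 2 n ≤ (s : ℝ) ^ 2) :
    4 * (t : ℝ) * 5 ^ s * (3 / 5 : ℝ) ^ (s * s) ≤ 1 := by
  have hn0 : (0 : ℝ) < n := by positivity
  have h1 : (5 : ℝ) * (3 / 5) ^ s ≤ (7 / 10) ^ s := by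
    have e : (5 : ℝ) ≤ (7 / 6) ^ s := by
      calc (5 : ℝ) ≤ (7 / 6) ^ 11 := by norm_num
        _ ≤ _ := pow_le_pow_right₀ (by norm_num) hs
    calc (5 : ℝ) * (3 / 5) ^ s ≤ (7 / 6) ^ s * (3 / 5) ^ s := by gcongr
      _ = (7 / 10) ^ s := by rw [← mul_pow]; norm_num
  have h2 : (5 : ℝ) ^ s * (3 / 5) ^ (s * s) ≤ (7 / 10) ^ (s * s) := by
    rw [pow_mul, pow_mul, ← mul_pow]
    exact pow_le_pow_left₀ (by positivity) h1 s
  have h3 : (n : ℝ) ^ 4 ≤ 2 ^ (s * s) := by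
    have e1 : (n : ℝ) ^ 4 = (2 : ℝ) ^ (4 * Real.logb 2 n) := by
      rw [mul_comm, Real.rpow_mul (by norm_num), Real.rpow_logb (by norm_num) (by norm_num) hn0]
      norm_cast
    have e2 : (2 : ℝ) ^ (s * s) = (2 : ℝ) ^ ((s : ℝ) ^ 2) := by
      rw [← Real.rpow_natCast]; push_cast; rw [sq]
    rw [e1, e2]
    exact Real.rpow_le_rpow_of_exponent_le (by norm_num) hsL
  have h4 : ((7 / 10 : ℝ) ^ (s * s)) ^ 2 * (n : ℝ) ^ 4 ≤ 1 := by
    calc ((7 / 10 : ℝ) ^ (s * s)) ^ 2 * (n : ℝ) ^ 4 ≤ ((7 / 10 : ℝ) ^ (s * s)) ^ 2 * 2 ^ (s * s) := by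
          gcongr
      _ = (49 / 50) ^ (s * s) := by rw [← pow_mul, mul_comm (s * s) 2, pow_mul, ← mul_pow]; norm_num
      _ ≤ 1 := pow_le_one₀ (by norm_num) (by norm_num)
  have h5 : (7 / 10 : ℝ) ^ (s * s) * (n : ℝ) ^ 2 ≤ 1 := by
    have : ((7 / 10 : ℝ) ^ (s * s) * (n : ℝ) ^ 2) ^ 2 ≤ 1 := by
      calc _ = ((7 / 10 : ℝ) ^ (s * s)) ^ 2 * (n : ℝ) ^ 4 := by ring
        _ ≤ 1 := h4
    nlinarith [show (0 : ℝ) ≤ (7 / 10 : ℝ) ^ (s * s) * (n : ℝ) ^ 2 by positivity]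
  have hn4 : (4 : ℝ) ≤ n := by exact_mod_cast hn
  have ht' : (t : ℝ) ≤ n := by exact_mod_cast ht
  calc 4 * (t : ℝ) * 5 ^ s * (3 / 5 : ℝ) ^ (s * s) = 4 * t * (5 ^ s * (3 / 5 : ℝ) ^ (s * s)) := by ring
    _ ≤ n * n * (7 / 10) ^ (s * s) := by gcongr
    _ = (7 / 10 : ℝ) ^ (s * s) * (n : ℝ) ^ 2 := by ring
    _ ≤ 1 := h5

lemma size_lem {n r s t : ℕ} {x : ℝ} (hr : 2 ≤ r) (hn : 1 ≤ n) (hx : 2 ≤ x)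
    (hs : (s : ℝ) ≤ 2 * x + 1) (ht : (t : ℝ) ≤ n / (570 * r * x) + 1)
    (hxn : 40 * x + 82 ≤ n / (4 * r)) : 10 * (t * (2 * s + 6)) ≤ (n - 1) / (2 * r) := by
  have hr0 : (0 : ℝ) < r := by positivity
  have hx0 : (0 : ℝ) < x := by linarith
  rw [Nat.le_div_iff_mul_le (by omega)]
  have h1 : (10 * (t * (2 * s + 6)) : ℝ) ≤ 40 * x + 80 + 8 / 57 * (n / r) := by
    have e1 : (t * (2 * s + 6) : ℝ) ≤ (n / (570 * r * x) + 1) * (4 * x + 8) :=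
      mul_le_mul ht (by linarith) (by positivity) (by positivity)
    have e2 : (n / (570 * r * x) : ℝ) * (4 * x + 8) ≤ 8 / 570 * (n / r) := by
      have : (n / (570 * r * x) : ℝ) * (8 * x) = 8 / 570 * (n / r) := by field_simp
      rw [← this]
      gcongr
      linarith
    nlinarith
  have h2 : (10 * (t * (2 * s + 6)) : ℝ) * (2 * r) ≤ n - 1 := by
    have e1 : (n / (4 * r) : ℝ) = 1 / 4 * (n / r) := by field_simp
    rw [e1] at hxn
    have e3 : (10 * (t * (2 * s + 6)) : ℝ) ≤ 1 / 2 * (n / r) - 2 := by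
      have : (0 : ℝ) ≤ n / r := by positivity
      linarith
    have hr2 : (2 : ℝ) ≤ r := by exact_mod_cast hr
    calc (10 * (t * (2 * s + 6)) : ℝ) * (2 * r) ≤ (1 / 2 * (n / r) - 2) * (2 * r) := by gcongr
      _ = n - 4 * r := by field_simp; ring
      _ ≤ _ := by linarith
  have h3 : ((10 * (t * (2 * s + 6)) * (2 * r) + 1 : ℕ) : ℝ) ≤ (n : ℕ) := by
    push_cast; linarith
  have h4 : 10 * (t * (2 * s + 6)) * (2 * r) + 1 ≤ n := by exact_mod_cast h3
  omega

lemma growth_low (r : ℕ) (hr : 2 ≤ r) : ∀ᶠ n : ℕ in Filter.atTop,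
    4 ≤ n ∧ 6 ≤ Real.sqrt (Real.logb 2 n) ∧
    40 * Real.sqrt (Real.logb 2 n) + 82 ≤ n / (4 * r) := by
  have hr0 : (0 : ℝ) < r := by positivity
  have h1 : Filter.Tendsto (fun n : ℕ => Real.logb 2 (n : ℝ)) Filter.atTop Filter.atTop :=
    (Real.tendsto_logb_atTop (by norm_num)).comp tendsto_natCast_atTop_atTop
  have h2 := (Real.isLittleO_log_id_atTop.comp_tendsto
    (tendsto_natCast_atTop_atTop (R := ℝ))).bound (show (0 : ℝ) < 1 / (1000 * r) by positivity)
  filter_upwards [Filter.eventually_ge_atTop 4, h1.eventually_ge_atTop 36, h2] with n hn hL hl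
  refine ⟨hn, ?_, ?_⟩
  · apply Real.le_sqrt_of_sq_le; linarith
  · have hx : Real.sqrt (Real.logb 2 n) ≤ Real.logb 2 n := by
      rw [Real.sqrt_le_left (by linarith)]
      nlinarith
    simp only [Function.comp, id, Real.norm_eq_abs] at hl
    rw [abs_of_nonneg (show (0 : ℝ) ≤ (n : ℝ) by positivity)] at hl
    have hl' := (le_abs_self _).trans hl
    have hlog : Real.logb 2 n ≤ 2 * Real.log n := by
      have e1 : Real.logb 2 n * Real.log 2 = Real.log n := by
        rw [Real.logb]; field_simp
      have := Real.log_two_gt_d9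
      nlinarith
    have e2 : (1 / (1000 * r) * n : ℝ) = 1 / 1000 * (n / r) := by field_simp
    have e3 : (n / (4 * r) : ℝ) = 1 / 4 * (n / r) := by field_simp
    have e4 : (0 : ℝ) ≤ n / r := by positivity
    rw [e2] at hl'
    rw [e3]
    linarith

lemma lower_real (r : ℕ) (hr : 2 ≤ r) : ∀ᶠ n : ℕ in Filter.atTop,
    (1 / (570 * (r : ℝ))) * n / Real.sqrt (Real.logb 2 n) ≤
        (NG.NGsumLow (NG.hadwiger n) r : ℝ) := by
  filter_upwards [growth_low r hr] with n ⟨hn, hx, hxn⟩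
  set x := Real.sqrt (Real.logb 2 n) with hxdef
  have hr2 : (2 : ℝ) ≤ r := by exact_mod_cast hr
  have hx0 : 0 < x := by linarith
  have hx2 : x ^ 2 = Real.logb 2 n := Real.sq_sqrt (by
    by_contra hc
    push Not at hc
    rw [Real.sqrt_eq_zero_of_nonpos hc.le] at hxdef
    linarith)
  set t := ⌈(n : ℝ) / (570 * r * x)⌉₊ with ht
  set s := ⌈2 * x⌉₊ with hs
  have hs1 : 2 * x ≤ s := Nat.le_ceil _
  have hs2 : (s : ℝ) ≤ 2 * x + 1 := (Nat.ceil_lt_add_one (by positivity)).le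
  have ht2 : (t : ℝ) ≤ n / (570 * r * x) + 1 := (Nat.ceil_lt_add_one (by positivity)).le
  have htn : t ≤ n := by
    rw [ht, Nat.ceil_le]
    apply div_le_self (by positivity)
    nlinarith
  have hs11 : 11 ≤ s := by
    have : (11 : ℝ) ≤ s := by linarith
    exact_mod_cast this
  have hnum := num_lem (n := n) (s := s) (t := t) hn hs11 htn (by rw [← hx2]; nlinarith)
  have hsize := size_lem (n := n) (r := r) (s := s) (t := t) (x := x) hr (by omega) (by linarith)
    hs2 ht2 hxn
  have htpos : 1 ≤ t := by
    rw [ht, Nat.one_le_ceil_iff]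
    have : (0 : ℝ) < n := by positivity
    positivity
  have hk : 1 ≤ (n - 1) / (2 * r) := by
    refine le_trans ?_ hsize
    nlinarith
  have hmem := Nat.sInf_mem (s := {s | ∃ G : Fin r → SimpleGraph (Fin n),
    NG.IsDecomp G ∧ ∑ i, NG.hadwiger n (G i) = s}) (by
      refine ⟨_, fun i => if (i : ℕ) = 0 then ⊤ else ⊥, ⟨?_, ?_⟩, rfl⟩
      · intro i j hij
        have : (i : ℕ) ≠ j := fun h => hij (Fin.ext h)
        by_cases hi : (i : ℕ) = 0
        · simp [hi, show (j : ℕ) ≠ 0 by omega]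
        · simp [hi]
      · refine top_le_iff.1 (le_trans ?_ (le_iSup _ (⟨0, by omega⟩ : Fin r)))
        simp)
  obtain ⟨G, hG, hsum⟩ := hmem
  obtain ⟨i, hi⟩ := exists_dense hr (by omega) G hG
  have hmin := minor_of_ec (G i) _ s t (by omega) hk hi (by omega) hsize hnum
  have h1 : t ≤ NG.hadwiger n (G i) := le_csSup (minor_bdd (G i)) hmin
  have h2 : NG.hadwiger n (G i) ≤ ∑ i, NG.hadwiger n (G i) :=
    single_le_sum (f := fun i => NG.hadwiger n (G i)) (fun _ _ => Nat.zero_le _) (mem_univ i)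
  have h3 : t ≤ NG.NGsumLow (NG.hadwiger n) r := by
    unfold NG.NGsumLow
    rw [← hsum]
    exact h1.trans h2
  calc (1 / (570 * (r : ℝ))) * n / x = n / (570 * r * x) := by field_simp
    _ ≤ t := Nat.le_ceil _
    _ ≤ _ := by exact_mod_cast h3

end NGproof

/-- For fixed `r ≥ 2`, for all sufficiently large `n`:
`(1/(570r))·n/√(log₂ n) ≤ NGΣ↓_η(r;n) ≤ r·n/√(log₂ n)`. -/
theorem statement5 (r : ℕ) (hr : 2 ≤ r) :
    ∀ᶠ n : ℕ in Filter.atTop,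
      (1 / (570 * (r : ℝ))) * n / Real.sqrt (Real.logb 2 n) ≤
        (NG.NGsumLow (NG.hadwiger n) r : ℝ) ∧
      (NG.NGsumLow (NG.hadwiger n) r : ℝ) ≤
        (r : ℝ) * n / Real.sqrt (Real.logb 2 n) := by
  filter_upwards [NGproof.lower_real r hr, NGproof.upper_real r hr] with n h1 h2
  exact ⟨h1, h2⟩
end

section
/- For every integer r ≥ 3 and every integer n ≥ 1, NGΣ↓_pw(r;n) ≤ 3⌈n/4⌉. -/
open scoped Classical

namespace NG

/-- The host caterpillar on `4q` vertices. -/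
def hostG (q : ℕ) : SimpleGraph (Fin (4*q)) where
  Adj i j := ((i:ℕ) < j ∧ (((i:ℕ) < q ∧ (j:ℕ) ≤ i + 2*q) ∨ (2*q ≤ (i:ℕ) ∧ (i:ℕ) < 3*q))) ∨
    ((j:ℕ) < i ∧ (((j:ℕ) < q ∧ (i:ℕ) ≤ j + 2*q) ∨ (2*q ≤ (j:ℕ) ∧ (j:ℕ) < 3*q)))
  symm := ⟨fun _ _ h => h.symm⟩
  loopless := ⟨fun _ h => by omega⟩

theorem mem_back (q : ℕ) (i j : Fin (4*q)) : i ∈ backNbhd (hostG q) j ↔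
    (i:ℕ) < j ∧ (((i:ℕ) < q ∧ (j:ℕ) ≤ i + 2*q) ∨ (2*q ≤ (i:ℕ) ∧ (i:ℕ) < 3*q)) := by
  have h : i ∈ backNbhd (hostG q) j ↔ (i:ℕ) < (j:ℕ) ∧ (hostG q).Adj i j := by
    unfold backNbhd
    simp
  rw [h]
  show _ ∧ (_ ∨ _) ↔ _
  omega

theorem back_card (q : ℕ) (j : Fin (4*q)) (hj : q < (j:ℕ)) :
    (backNbhd (hostG q) j).card = q := by
  have hlt := j.2
  conv_rhs => rw [← Finset.card_range q]
  refine Finset.card_bij (fun i _ => if (i:ℕ) < q then (i:ℕ) else (i:ℕ) - 2*q) ?_ ?_ ?_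
  · intro a ha
    rw [mem_back] at ha
    rw [Finset.mem_range]
    split_ifs <;> omega
  · intro a ha b hb h
    rw [mem_back] at ha hb
    apply Fin.ext
    split_ifs at h <;> omega
  · intro t ht
    rw [Finset.mem_range] at ht
    by_cases h : t + 2*q < j
    · refine ⟨⟨t + 2*q, by omega⟩, ?_, ?_⟩
      · rw [mem_back]; dsimp only; omega
      · dsimp only; split_ifs <;> omega
    · refine ⟨⟨t, by omega⟩, ?_, ?_⟩
      · rw [mem_back]; dsimp only; omega
      · dsimp only; split_ifs; rfl

theorem host_cat (q : ℕ) (hq : 1 ≤ q) : IsCaterpillarOrd q (4*q) (hostG q) := by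
  refine ⟨⟨hq, by omega, ?_, ?_⟩, ?_⟩
  · intro i j hij hj
    left; omega
  · intro j hj
    refine ⟨back_card q j hj, ?_⟩
    intro a ha b hb hab
    rw [Finset.mem_coe, mem_back] at ha hb
    have : (a:ℕ) ≠ b := fun h => hab (Fin.ext h)
    show _ ∨ _
    omega
  · intro i j hij hj x hx
    rw [mem_back] at hx
    rw [Finset.mem_insert, mem_back]
    have : x = i ∨ (x:ℕ) ≠ i := by
      by_cases h : (x:ℕ) = i
      · exact Or.inl (Fin.ext h)
      · exact Or.inr h
    rcases this with h | h
    · exact Or.inl h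
    · right; omega

theorem pw_le_of {n q : ℕ} (hq : 1 ≤ q) (G : SimpleGraph (Fin n)) (f : Fin n ↪ Fin (4*q))
    (h : ∀ u v, G.Adj u v → (hostG q).Adj (f u) (f v)) : pw n G ≤ q := by
  unfold pw widthParam
  split_ifs
  · omega
  · exact Nat.sInf_le ⟨4*q, hostG q, f, host_cat q hq, h⟩

theorem pw_bot (n : ℕ) : pw n ⊥ = 0 := by simp [pw, widthParam]

/-- block permutation one -/
def e0 {n q : ℕ} (h : n ≤ 4*q) : Fin n ↪ Fin (4*q) :=
  ⟨fun v => ⟨v, by omega⟩, fun a b hab => by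
    rw [Fin.mk.injEq] at hab; exact Fin.ext hab⟩

/-- block permutation two -/
def e1 {n q : ℕ} (h : n ≤ 4*q) : Fin n ↪ Fin (4*q) :=
  ⟨fun v => ⟨if (v:ℕ) < q then v + 2*q else if (v:ℕ) < 2*q then v - q else
    if (v:ℕ) < 3*q then v + q else v - 2*q, by split_ifs <;> omega⟩, fun a b hab => by
    rw [Fin.mk.injEq] at hab; apply Fin.ext; split_ifs at hab <;> omega⟩

/-- block permutation three -/
def e2 {n q : ℕ} (h : n ≤ 4*q) : Fin n ↪ Fin (4*q) :=
  ⟨fun v => ⟨if (v:ℕ) < 3*q then v + q else v - 3*q, by split_ifs <;> omega⟩, fun a b hab => by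
    rw [Fin.mk.injEq] at hab; apply Fin.ext; split_ifs at hab <;> omega⟩

theorem host_adj {q : ℕ} (i j : Fin (4*q)) : (hostG q).Adj i j ↔
    ((i:ℕ) < j ∧ (((i:ℕ) < q ∧ (j:ℕ) ≤ i + 2*q) ∨ (2*q ≤ (i:ℕ) ∧ (i:ℕ) < 3*q))) ∨
    ((j:ℕ) < i ∧ (((j:ℕ) < q ∧ (i:ℕ) ≤ j + 2*q) ∨ (2*q ≤ (j:ℕ) ∧ (j:ℕ) < 3*q))) := Iff.rfl

theorem e0_val {n q : ℕ} (h : n ≤ 4*q) (v : Fin n) : ((e0 h v : Fin (4*q)) : ℕ) = v := rfl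

theorem e1_val {n q : ℕ} (h : n ≤ 4*q) (v : Fin n) : ((e1 h v : Fin (4*q)) : ℕ) =
    if (v:ℕ) < q then v + 2*q else if (v:ℕ) < 2*q then v - q else
    if (v:ℕ) < 3*q then v + q else v - 2*q := rfl

theorem e2_val {n q : ℕ} (h : n ≤ 4*q) (v : Fin n) : ((e2 h v : Fin (4*q)) : ℕ) =
    if (v:ℕ) < 3*q then v + q else v - 3*q := rfl

theorem cover {n q : ℕ} (h : n ≤ 4*q) (u v : Fin n) (huv : (u:ℕ) < v) :
    (hostG q).Adj (e0 h u) (e0 h v) ∨ (hostG q).Adj (e1 h u) (e1 h v) ∨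
    (hostG q).Adj (e2 h u) (e2 h v) := by
  have hu := u.2
  have hv := v.2
  simp only [host_adj, e0_val, e1_val, e2_val]
  split_ifs <;> omega

/-- the parts -/
def part {n : ℕ} (A B : SimpleGraph (Fin n)) : ℕ → SimpleGraph (Fin n)
  | 0 => A
  | 1 => B \ A
  | 2 => (A ⊔ B)ᶜ
  | _ + 3 => ⊥

theorem part_disj {n : ℕ} (A B : SimpleGraph (Fin n)) (i j : ℕ) (h : i ≠ j) :
    Disjoint (part A B i) (part A B j) := by
  have h01 : Disjoint A (B \ A) := disjoint_sdiff_self_right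
  have h02 : Disjoint A (A ⊔ B)ᶜ := disjoint_compl_right.mono_left le_sup_left
  have h12 : Disjoint (B \ A) (A ⊔ B)ᶜ :=
    disjoint_compl_right.mono_left (sdiff_le.trans le_sup_right)
  match i, j with
  | 0, 0 | 1, 1 | 2, 2 => exact absurd rfl h
  | 0, 1 => exact h01
  | 1, 0 => exact h01.symm
  | 0, 2 => exact h02
  | 2, 0 => exact h02.symm
  | 1, 2 => exact h12
  | 2, 1 => exact h12.symm
  | _ + 3, _ => exact disjoint_bot_left
  | _, _ + 3 => exact disjoint_bot_right

end NG

open NG in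
/-- For every `r ≥ 3` and `n ≥ 1`: `NGΣ↓_pw(r;n) ≤ 3⌈n/4⌉`. -/
theorem statement6 (r n : ℕ) (hr : 3 ≤ r) (hn : 1 ≤ n) :
    NG.NGsumLow (NG.pw n) r ≤ 3 * ((n + 3) / 4) := by
  obtain ⟨q, hqd⟩ : ∃ q, q = (n + 3) / 4 := ⟨_, rfl⟩
  rw [← hqd]
  have h : n ≤ 4*q := by omega
  have hq : 1 ≤ q := by omega
  obtain ⟨m, rfl⟩ : ∃ m, r = m + 3 := ⟨r - 3, by omega⟩
  set A := (hostG q).comap (e0 h) with hA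
  set B := (hostG q).comap (e1 h) with hB
  have p0 : pw n A ≤ q := pw_le_of hq _ (e0 h) fun u v huv => huv
  have p1 : pw n (B \ A) ≤ q := pw_le_of hq _ (e1 h) fun u v huv => huv.1
  have p2 : pw n (A ⊔ B)ᶜ ≤ q := by
    refine pw_le_of hq _ (e2 h) fun u v huv => ?_
    rw [SimpleGraph.compl_adj, SimpleGraph.sup_adj, not_or] at huv
    obtain ⟨hne, ha, hb⟩ := huv
    have hne' : (u:ℕ) ≠ v := fun h => hne (Fin.ext h)
    rcases lt_or_gt_of_ne hne' with hl | hl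
    · rcases cover h u v hl with h | h | h
      · exact absurd h ha
      · exact absurd h hb
      · exact h
    · rcases cover h v u hl with h | h | h
      · exact absurd h.symm ha
      · exact absurd h.symm hb
      · exact h.symm
  have key : ∀ G : Fin (m+3) → SimpleGraph (Fin n), IsDecomp G →
      NGsumLow (pw n) (m+3) ≤ ∑ i, pw n (G i) := fun G hG => Nat.sInf_le ⟨G, hG, rfl⟩
  refine (key (fun i : Fin (m+3) => part A B i) ⟨?_, ?_⟩).trans ?_
  · intro i j hij
    exact part_disj A B i j fun h => hij (Fin.ext h)
  · rw [eq_top_iff]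
    have h0 := le_iSup (fun i : Fin (m+3) => part A B i) ⟨0, by omega⟩
    have h1 := le_iSup (fun i : Fin (m+3) => part A B i) ⟨1, by omega⟩
    have h2 := le_iSup (fun i : Fin (m+3) => part A B i) ⟨2, by omega⟩
    simp only [part] at h0 h1 h2
    rw [← sup_compl_eq_top (x := A ⊔ B)]
    refine sup_le (sup_le h0 ?_) h2
    have : B ≤ A ⊔ B \ A := by rw [sup_sdiff_self_right]; exact le_sup_right
    exact this.trans (sup_le h0 h1)
  · rw [Fin.sum_univ_succ, Fin.sum_univ_succ, Fin.sum_univ_succ]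
    have hz : ∑ i : Fin m, pw n (part A B (i.succ.succ.succ : Fin (m+3))) = 0 := by
      refine Finset.sum_eq_zero fun i _ => ?_
      exact pw_bot n
    rw [hz]
    have a0 : pw n (part A B ((0 : Fin (m+3)) : ℕ)) ≤ q := p0
    have a1 : pw n (part A B ((Fin.succ (0 : Fin (m+2)) : Fin (m+3)) : ℕ)) ≤ q := p1
    have a2 : pw n (part A B ((Fin.succ (Fin.succ (0 : Fin (m+1))) : Fin (m+3)) : ℕ)) ≤ q := p2
    omega
end

section
/- Let β ∈ {tw, la, pw} and let r ≥ 3. Then NGΣ↓_β(r;n) ≤ 3⌈n/4⌉ for every n ≥ 1, and for all sufficiently large n (in particular whenever a non-degenerate r-decomposition of K_n exists and n ≥ 4r), NGΣ↓ⁿ_β(r;n) ≤ 3⌈n/4⌉ + r − 3. -/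
open scoped Classical

namespace NGAux

open NG

/-- back relation of the standard caterpillar -/
def R (m i j : ℕ) : Prop :=
  i < j ∧ ((min (j - 2 * m) m ≤ i ∧ i < m) ∨ (2 * m ≤ i ∧ i < 2 * m + min (j - 2 * m) m))

def cat (m N : ℕ) : SimpleGraph (Fin N) where
  Adj p q := R m p q ∨ R m q p
  symm := ⟨fun p q h => Or.symm h⟩
  loopless := ⟨fun p h => by rcases h with h | h <;> exact absurd h.1 (lt_irrefl _)⟩

lemma mem_back (m N : ℕ) (i j : Fin N) : i ∈ backNbhd (cat m N) j ↔ R m i j := by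
  unfold backNbhd
  rw [Finset.mem_filter]
  constructor
  · rintro ⟨-, h, h1 | h1⟩
    · exact h1
    · exact absurd h1.1 (by omega)
  · intro h
    exact ⟨Finset.mem_univ _, h.1, Or.inl h⟩

lemma cat_isCat (m N : ℕ) (hm : 1 ≤ m) (hN : m + 1 ≤ N) : IsCaterpillarOrd m N (cat m N) := by
  refine ⟨⟨hm, hN, ?_, ?_⟩, ?_⟩
  · intro i j hij hj
    left
    unfold R
    omega
  · intro j hj
    constructor
    · have hj2 := j.2
      have : (Finset.range m).card = (backNbhd (cat m N) j).card := by
        refine Finset.card_bij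
          (fun x hx => (⟨if x < min ((j : ℕ) - 2 * m) m then 2 * m + x else x, by
            rw [Finset.mem_range] at hx
            split_ifs <;> omega⟩ : Fin N)) ?_ ?_ ?_
        · intro x hx
          rw [Finset.mem_range] at hx
          rw [mem_back]
          unfold R
          dsimp only
          split_ifs <;> omega
        · intro x hx y hy h
          rw [Finset.mem_range] at hx hy
          simp only [Fin.mk.injEq] at h
          split_ifs at h <;> omega
        · intro b hb
          rw [mem_back] at hb
          unfold R at hb
          by_cases h : (b : ℕ) < m
          · refine ⟨b, by simpa using h, ?_⟩
            ext
            dsimp only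
            split_ifs <;> omega
          · refine ⟨b - 2 * m, by rw [Finset.mem_range]; omega, ?_⟩
            ext
            dsimp only
            split_ifs <;> omega
      rw [← this, Finset.card_range]
    · intro a ha b hb hab
      rw [Finset.mem_coe, mem_back] at ha hb
      have hab' : (a : ℕ) ≠ b := fun h => hab (Fin.ext h)
      unfold R at ha hb
      show R m a b ∨ R m b a
      unfold R
      omega
  · intro i j hij hj x hx
    rw [mem_back] at hx
    rw [Finset.mem_insert, mem_back, Fin.ext_iff]
    unfold R at *
    omega

lemma cat_twoSided (k N : ℕ) (H : SimpleGraph (Fin N)) (h : IsCaterpillarOrd k N H) :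
    IsTwoSidedKTreeOrd k N H := by
  refine ⟨h.1, ?_⟩
  obtain ⟨⟨hk, hN, h0, h1⟩, h2⟩ := h
  intro j hj
  have hj2 := j.2
  have hcard := (h1 j hj).1
  by_cases hj' : (j : ℕ) = k + 1
  · left
    have hne : (backNbhd H j).Nonempty := by
      rw [← Finset.card_pos]; omega
    obtain ⟨u, hu⟩ := hne
    refine ⟨u, hu, ?_⟩
    have hu' : (u : ℕ) < j := by
      simp only [backNbhd, Finset.mem_filter] at hu
      exact hu.2.1
    have : (Finset.univ.filter (fun w : Fin N => (w : ℕ) < j ∧ (u : ℕ) < j ∧ H.Adj u w))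
        = (Finset.Iio j).erase u := by
      ext w
      simp only [Finset.mem_filter, Finset.mem_univ, true_and, Finset.mem_erase, Finset.mem_Iio,
        Fin.lt_def]
      constructor
      · rintro ⟨a, b, c⟩
        exact ⟨fun h => by subst h; exact H.irrefl c, a⟩
      · rintro ⟨a, b⟩
        refine ⟨b, hu', ?_⟩
        have : (u : ℕ) ≠ w := fun h => a (Fin.ext h.symm)
        rcases lt_or_gt_of_ne this with h | h
        · exact h0 _ _ h (by omega)
        · exact (h0 _ _ h (by omega)).symm
    unfold stageDeg
    rw [this, Finset.card_erase_of_mem (Finset.mem_Iio.2 (Fin.lt_def.2 hu')), Fin.card_Iio]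
    omega
  · let i : Fin N := ⟨j - 1, by omega⟩
    have hi : (i : ℕ) + 1 = j := by show (j : ℕ) - 1 + 1 = j; omega
    have hsub := h2 i j hi (by omega)
    have hicard := (h1 i (by omega)).1
    by_cases hmem : i ∈ backNbhd H j
    · left
      refine ⟨i, hmem, ?_⟩
      rw [← hicard]
      unfold stageDeg backNbhd
      congr 1
      ext w
      simp only [Finset.mem_filter, Finset.mem_univ, true_and]
      constructor
      · rintro ⟨a, b, c⟩
        have : (w : ℕ) ≠ i := fun h => by
          have := Fin.ext h
          subst this; exact H.irrefl c
        exact ⟨by omega, c.symm⟩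
      · rintro ⟨a, b⟩
        exact ⟨by omega, by omega, b.symm⟩
    · right
      refine ⟨i, by omega, by omega, ?_⟩
      symm
      apply Finset.eq_of_subset_of_card_le
      · exact (Finset.subset_insert_iff_of_notMem hmem).1 hsub
      · omega

lemma width_le (β : (n : ℕ) → SimpleGraph (Fin n) → ℕ)
    (hβ : β = NG.treewidth ∨ β = NG.la ∨ β = NG.pw) (k n N : ℕ) (hk : 1 ≤ k) (hN : k + 1 ≤ N)
    (G : SimpleGraph (Fin n)) (f : Fin n ↪ Fin N)
    (hf : ∀ u v : Fin n, G.Adj u v → R k (f u) (f v) ∨ R k (f v) (f u)) : β n G ≤ k := by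
  have hc := cat_isCat k N hk hN
  have key : ∀ P : ℕ → (N : ℕ) → SimpleGraph (Fin N) → Prop, P k N (cat k N) →
      widthParam P n G ≤ k := by
    intro P hP
    unfold widthParam
    split_ifs
    · omega
    · exact Nat.sInf_le ⟨N, cat k N, f, hP, hf⟩
  rcases hβ with rfl | rfl | rfl
  · exact key _ hc.1
  · exact key _ (cat_twoSided _ _ _ hc)
  · exact key _ hc

lemma width_bot (β : (n : ℕ) → SimpleGraph (Fin n) → ℕ)
    (hβ : β = NG.treewidth ∨ β = NG.la ∨ β = NG.pw) (n : ℕ) :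
    β n ⊥ = 0 := by
  rcases hβ with rfl | rfl | rfl <;> simp [treewidth, la, pw, widthParam]

/-- base colouring -/
def base (a b : ℕ) : ℕ :=
  if a % 4 + b % 4 = 2 ∨ (a % 4 + b % 4 = 4 ∧ a % 4 ≠ b % 4) then 1
  else if a % 4 + b % 4 = 3 ∨ a % 4 + b % 4 = 6 then 2 else 0

/-- the colouring with `s - 3` extra single-edge colours -/
def col (s a b : ℕ) : ℕ :=
  if a % 4 + b % 4 = 1 ∧ a / 4 = b / 4 ∧ 3 ≤ a / 4 ∧ a / 4 < s then a / 4 else base a b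

lemma col_symm (s a b : ℕ) : col s a b = col s b a := by
  unfold col base
  split_ifs <;> omega

lemma col_lt (s a b : ℕ) (hs : 3 ≤ s) : col s a b < s := by
  unfold col base
  split_ifs <;> omega

def gr (n s i : ℕ) : SimpleGraph (Fin n) where
  Adj a b := a ≠ b ∧ col s a b = i
  symm := ⟨fun a b h => ⟨h.1.symm, by rw [col_symm]; exact h.2⟩⟩
  loopless := ⟨fun a h => h.1 rfl⟩

lemma gr_decomp (n s r : ℕ) (hs : 3 ≤ s) (hr : s ≤ r) :
    IsDecomp (fun i : Fin r => gr n s i) := by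
  constructor
  · intro i j hij
    rw [SimpleGraph.disjoint_left]
    intro a b h1 h2
    exact hij (Fin.ext (h1.2.symm.trans h2.2))
  · ext a b
    simp only [SimpleGraph.iSup_adj, SimpleGraph.top_adj]
    constructor
    · rintro ⟨i, h⟩
      exact h.1
    · intro h
      exact ⟨⟨col s a b, (col_lt s a b hs).trans_le hr⟩, h, rfl⟩

def pos (c m v : ℕ) : ℕ :=
  if c = 0 then (v % 4) * m + v / 4
  else if c = 1 then
    (if v % 4 = 1 then v / 4 else if v % 4 = 3 then m + v / 4 else
      if v % 4 = 2 then 2 * m + v / 4 else 3 * m + v / 4)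
  else
    (if v % 4 = 3 then v / 4 else if v % 4 = 0 then m + v / 4 else
      if v % 4 = 1 then 2 * m + v / 4 else 3 * m + v / 4)

lemma pos0 (m v : ℕ) : pos 0 m v =
    (if v % 4 = 0 then v / 4 else if v % 4 = 1 then m + v / 4 else
      if v % 4 = 2 then 2 * m + v / 4 else 3 * m + v / 4) := by
  unfold pos
  have : v % 4 < 4 := Nat.mod_lt _ (by norm_num)
  interval_cases h : v % 4 <;> simp

lemma pos_lt (c m n v : ℕ) (hc : c < 3) (hn : n ≤ 4 * m) (hv : v < n) : pos c m v < 4 * m := by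
  interval_cases c
  · rw [pos0]; split_ifs <;> omega
  · unfold pos; simp only [one_ne_zero, if_false, if_true]; split_ifs <;> omega
  · unfold pos; simp only [OfNat.ofNat_ne_zero, OfNat.ofNat_ne_one, if_false]; split_ifs <;> omega

lemma pos_inj (c m n u v : ℕ) (hc : c < 3) (hn : n ≤ 4 * m) (hu : u < n) (hv : v < n)
    (h : pos c m u = pos c m v) : u = v := by
  interval_cases c
  · rw [pos0, pos0] at h; split_ifs at h <;> omega
  · unfold pos at h; simp only [one_ne_zero, if_false, if_true] at h; split_ifs at h <;> omega
  · unfold pos at h; simp only [OfNat.ofNat_ne_zero, OfNat.ofNat_ne_one, if_false] at h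
    split_ifs at h <;> omega

lemma pos_R (c m n s u v : ℕ) (hc : c < 3) (hn : n ≤ 4 * m) (hu : u < n) (hv : v < n)
    (hne : u ≠ v) (h : col s u v = c) :
    R m (pos c m u) (pos c m v) ∨ R m (pos c m v) (pos c m u) := by
  have hb : base u v = c := by
    unfold col at h
    split_ifs at h
    · omega
    · exact h
  have hu4 : u % 4 < 4 := Nat.mod_lt _ (by norm_num)
  have hv4 : v % 4 < 4 := Nat.mod_lt _ (by norm_num)
  have hu5 : u / 4 < m := by omega
  have hv5 : v / 4 < m := by omega
  have hd : u % 4 = v % 4 → u / 4 ≠ v / 4 := by omega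
  unfold base at hb
  unfold R
  generalize hx : u % 4 = x at *
  generalize hy : v % 4 = y at *
  interval_cases c <;> interval_cases x <;> interval_cases y <;>
    simp [pos, hx, hy] at hb hd ⊢ <;> omega

lemma sum_le (n s r : ℕ) (hn : 1 ≤ n) (hs : 3 ≤ s) (hr : s ≤ r) (hsn : s = 3 ∨ 4 * s ≤ n)
    (β : (n : ℕ) → SimpleGraph (Fin n) → ℕ)
    (hβ : β = NG.treewidth ∨ β = NG.la ∨ β = NG.pw) :
    ∑ i : Fin r, β n (gr n s i) ≤ 3 * ((n + 3) / 4) + (s - 3) := by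
  set m := (n + 3) / 4 with hm
  have hb : ∀ i : ℕ, β n (gr n s i) ≤ if i < 3 then m else if i < s then 1 else 0 := by
    intro i
    split_ifs with h1 h2
    · refine width_le β hβ m n (4 * m) (by omega) (by omega) _
        ⟨fun v => ⟨pos i m v, pos_lt i m n v h1 (by omega) v.2⟩, ?_⟩ ?_
      · intro u v h
        exact Fin.ext (pos_inj i m n u v h1 (by omega) u.2 v.2 (by simpa using h))
      · intro u v h
        exact pos_R i m n s u v h1 (by omega) u.2 v.2 (fun e => h.1 (Fin.ext e)) h.2
    · refine width_le β hβ 1 n (n + 2) le_rfl (by omega) _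
        ⟨fun v => ⟨if (v : ℕ) = 4 * i then 0 else if (v : ℕ) = 4 * i + 1 then 1 else v + 2, by
          have := v.2
          split_ifs <;> omega⟩, ?_⟩ ?_
      · intro u v h
        simp only [Fin.mk.injEq] at h
        ext
        split_ifs at h <;> omega
      · intro u v h
        have h2 := h.2
        unfold col base at h2
        have : ((u : ℕ) = 4 * i ∧ (v : ℕ) = 4 * i + 1) ∨ ((v : ℕ) = 4 * i ∧ (u : ℕ) = 4 * i + 1) := by
          split_ifs at h2 <;> omega
        let g : ℕ → ℕ := fun v => if v = 4 * i then 0 else if v = 4 * i + 1 then 1 else v + 2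
        show R 1 (g u) (g v) ∨ R 1 (g v) (g u)
        unfold R
        simp only [g]
        split_ifs <;> omega
    · have : gr n s i = ⊥ := by
        ext a b
        simp only [SimpleGraph.bot_adj, iff_false]
        intro h
        have := col_lt s a b hs
        have := h.2
        omega
      rw [this, width_bot β hβ]
  calc ∑ i : Fin r, β n (gr n s i)
      ≤ ∑ i : Fin r, (if (i : ℕ) < 3 then m else if (i : ℕ) < s then 1 else 0) :=
        Finset.sum_le_sum (fun i _ => hb i)
    _ = ∑ i ∈ Finset.range r, (if i < 3 then m else if i < s then 1 else 0) :=
        Fin.sum_univ_eq_sum_range (fun i => if i < 3 then m else if i < s then 1 else 0) r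
    _ = 3 * m + (s - 3) := by
        obtain ⟨p, rfl⟩ := Nat.exists_eq_add_of_le hs
        obtain ⟨q, rfl⟩ := Nat.exists_eq_add_of_le hr
        rw [Finset.sum_range_add, Finset.sum_range_add]
        have e1 : ∀ x ∈ Finset.range p,
            (if 3 + x < 3 then m else if 3 + x < 3 + p then 1 else 0) = 1 := by
          intro x hx
          rw [Finset.mem_range] at hx
          simp [hx]
        have e2 : ∀ x ∈ Finset.range q,
            (if 3 + p + x < 3 then m else if 3 + p + x < 3 + p then 1 else 0) = 0 := by
          intro x hx
          split_ifs <;> omega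
        rw [Finset.sum_congr rfl e1, Finset.sum_congr rfl e2]
        simp [Finset.sum_range_succ]
        omega

lemma gr_ne_bot (n r i : ℕ) (hr : 3 ≤ r) (hn : 4 * r ≤ n) (hi : i < r) : gr n r i ≠ ⊥ := by
  have key : ∀ a b : ℕ, a < n → b < n → a ≠ b → col r a b = i → gr n r i ≠ ⊥ := by
    intro a b ha hb hab h e
    have : (gr n r i).Adj ⟨a, ha⟩ ⟨b, hb⟩ := ⟨fun h => hab (by simpa using h), h⟩
    rw [e] at this
    exact this
  by_cases h : i < 3
  · interval_cases i
    · exact key 0 1 (by omega) (by omega) (by omega) (by simp [col, base])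
    · exact key 0 2 (by omega) (by omega) (by omega) (by simp [col, base])
    · exact key 0 3 (by omega) (by omega) (by omega) (by simp [col, base])
  · refine key (4 * i) (4 * i + 1) (by omega) (by omega) (by omega) ?_
    unfold col
    split_ifs <;> omega

end NGAux

/-- For `β ∈ {tw, la, pw}` and `r ≥ 3`: `NGΣ↓_β(r;n) ≤ 3⌈n/4⌉` for all `n ≥ 1`,
and `NGΣ↓ⁿ_β(r;n) ≤ 3⌈n/4⌉ + r − 3` for all `n ≥ 4r`. -/
theorem statement7 (r : ℕ) (hr : 3 ≤ r)
    (β : (n : ℕ) → SimpleGraph (Fin n) → ℕ)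
    (hβ : β = NG.treewidth ∨ β = NG.la ∨ β = NG.pw) :
    (∀ n : ℕ, 1 ≤ n → NG.NGsumLow (β n) r ≤ 3 * ((n + 3) / 4)) ∧
    (∀ n : ℕ, 4 * r ≤ n →
      NG.NGsumLowND (β n) r ≤ 3 * ((n + 3) / 4) + r - 3) := by
  constructor
  · intro n hn
    have h := NGAux.sum_le n 3 r hn le_rfl hr (Or.inl rfl) β hβ
    unfold NG.NGsumLow
    refine le_trans (Nat.sInf_le ?_) h
    exact ⟨_, NGAux.gr_decomp n 3 r le_rfl hr, rfl⟩
  · intro n hn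
    have h := NGAux.sum_le n r r (by omega) hr le_rfl (Or.inr hn) β hβ
    unfold NG.NGsumLowND
    refine le_trans (Nat.sInf_le ?_) (h.trans (by omega))
    refine ⟨_, ⟨NGAux.gr_decomp n r r hr le_rfl, fun i => ?_⟩, rfl⟩
    exact NGAux.gr_ne_bot n r i hr hn i.2
end

section
/- Let r ≥ 3. Then NGΣ↓_ppw(r;n) ≤ 3⌈n/4⌉ + r for every n ≥ 1, and for all sufficiently large n (in particular whenever a non-degenerate r-decomposition of K_n exists and n ≥ 4r), NGΣ↓ⁿ_ppw(r;n) ≤ 3⌈n/4⌉ + 2r − 3. -/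
open scoped Classical

namespace NG

/-- Backward adjacency of the host linear tree. -/
def bAdj (q i j : ℕ) : Prop :=
  j < q ∨ (q ≤ j ∧ j < 2*q ∧ (i < q ∨ i + 1 = j)) ∨
  (2*q ≤ j ∧ j < 3*q ∧ ((j ≤ i + 2*q ∧ i < q) ∨ i + 1 = 2*q ∨ 2*q ≤ i)) ∨
  (3*q ≤ j ∧ ((2*q ≤ i ∧ i < 3*q) ∨ i + 1 = j ∨ (j = 3*q ∧ i + 1 = 2*q)))

/-- The graph given by a backward adjacency relation. -/
def bGraph (N : ℕ) (P : ℕ → ℕ → Prop) : SimpleGraph (Fin N) where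
  Adj x y := (x.1 < y.1 ∧ P x.1 y.1) ∨ (y.1 < x.1 ∧ P y.1 x.1)
  symm := ⟨fun _ _ h => h.symm⟩
  loopless := ⟨fun _ h => by rcases h with h | h <;> omega⟩

lemma mem_back_s8 {N : ℕ} {P : ℕ → ℕ → Prop} (i j : Fin N) :
    i ∈ backNbhd (bGraph N P) j ↔ i.1 < j.1 ∧ P i.1 j.1 := by
  unfold backNbhd
  rw [Finset.mem_filter]
  simp only [Finset.mem_univ, true_and]
  constructor
  · rintro ⟨h, h1 | h1⟩
    · exact h1
    · omega
  · rintro ⟨h, h1⟩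
    exact ⟨h, Or.inl ⟨h, h1⟩⟩

lemma card_back {N : ℕ} {P : ℕ → ℕ → Prop} (j : Fin N) (S : Finset ℕ)
    (h : ∀ i, i ∈ S ↔ i < j.1 ∧ P i j.1) :
    (backNbhd (bGraph N P) j).card = S.card := by
  rw [← Finset.card_map Fin.valEmbedding]
  congr 1
  ext i
  simp only [Finset.mem_map, mem_back_s8, h, Fin.valEmbedding_apply]
  constructor
  · rintro ⟨a, ha, rfl⟩; exact ha
  · rintro ha; exact ⟨⟨i, by omega⟩, ha, rfl⟩

lemma isLinear_host (q : ℕ) (hq : 1 ≤ q) :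
    IsLinearKTreeOrd (q+1) (4*q) (bGraph (4*q) (bAdj q)) := by
  refine ⟨⟨by omega, by omega, ?_, ?_⟩, ?_⟩
  · intro i j hij hj
    refine Or.inl ⟨hij, ?_⟩
    unfold bAdj; omega
  · intro j hj
    have hj4 := j.2
    constructor
    · by_cases h1 : j.1 < 2*q
      · rw [card_back j (insert (j.1-1) (Finset.range q))]
        · rw [Finset.card_insert_of_notMem (by simp; omega)]; simp
        · intro i; simp only [Finset.mem_insert, Finset.mem_range, bAdj]; omega
      by_cases h2 : j.1 < 3*q
      · rw [card_back j (Finset.Ico (j.1-2*q) q ∪ Finset.Ico (2*q-1) j.1)]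
        · rw [Finset.card_union_of_disjoint]
          · simp; omega
          · rw [Finset.disjoint_left]; intro a; simp; omega
        · intro i; simp only [Finset.mem_union, Finset.mem_Ico, bAdj]; omega
      by_cases h3 : j.1 = 3*q
      · rw [card_back j (Finset.Ico (2*q-1) (3*q))]
        · simp; omega
        · intro i; simp only [Finset.mem_Ico, bAdj]; omega
      · rw [card_back j (insert (j.1-1) (Finset.Ico (2*q) (3*q)))]
        · rw [Finset.card_insert_of_notMem (by simp; omega)]; simp; omega
        · intro i; simp only [Finset.mem_insert, Finset.mem_Ico, bAdj]; omega
    · intro x hx y hy hxy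
      rw [Finset.mem_coe, mem_back_s8] at hx hy
      have hne : x.1 ≠ y.1 := fun h => hxy (Fin.ext h)
      show (x.1 < y.1 ∧ bAdj q x.1 y.1) ∨ (y.1 < x.1 ∧ bAdj q y.1 x.1)
      unfold bAdj at *
      omega
  · intro i j hij hj
    rw [mem_back_s8]
    have := j.2
    unfold bAdj
    omega

lemma isLinear_path (N : ℕ) (hN : 2 ≤ N) :
    IsLinearKTreeOrd 1 N (bGraph N (fun i j => i + 1 = j)) := by
  refine ⟨⟨by omega, by omega, ?_, ?_⟩, ?_⟩
  · intro i j hij hj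
    exact Or.inl ⟨hij, by omega⟩
  · intro j hj
    constructor
    · rw [card_back j {j.1-1}]
      · simp
      · intro i; simp only [Finset.mem_singleton]; omega
    · intro x hx y hy hxy
      rw [Finset.mem_coe, mem_back_s8] at hx hy
      exact absurd (Fin.ext (by omega)) hxy
  · intro i j hij hj
    rw [mem_back_s8]
    omega

lemma ppw_le {n k N : ℕ} (G : SimpleGraph (Fin n)) (H : SimpleGraph (Fin N))
    (hH : IsLinearKTreeOrd k N H) (f : Fin n → Fin N) (hf : Function.Injective f)
    (h : ∀ u v, u.1 < v.1 → G.Adj u v → H.Adj (f u) (f v)) : ppw n G ≤ k := by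
  unfold ppw widthParam
  split_ifs
  · omega
  · refine Nat.sInf_le ⟨N, H, ⟨f, hf⟩, hH, ?_⟩
    intro u v huv
    rcases lt_trichotomy u.1 v.1 with h1 | h1 | h1
    · exact h u v h1 huv
    · exact absurd (Fin.ext h1) huv.ne
    · exact (h v u h1 huv.symm).symm

/-- colour of a pair by blocks, `a ≤ b`. -/
def bcol (a b : ℕ) : ℕ :=
  if (a = 0 ∧ b = 2) ∨ (a = 1 ∧ b = 3) ∨ (a = 1 ∧ b = 1) then 1
  else if (a = 0 ∧ b = 3) ∨ (a = 1 ∧ b = 2) ∨ (a = 3 ∧ b = 3) then 2 else 0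

/-- block permutations. -/
def bperm (c a : ℕ) : ℕ :=
  if c = 0 then a
  else if c = 1 then (if a = 0 then 2 else if a = 1 then 0 else if a = 2 then 3 else 1)
  else (if a = 0 then 1 else if a = 1 then 2 else if a = 2 then 3 else 0)

lemma bperm_lt (c a : ℕ) (ha : a < 4) : bperm c a < 4 := by
  unfold bperm; split_ifs <;> omega

lemma bperm_inj (c a b : ℕ) (ha : a < 4) (hb : b < 4) (h : bperm c a = bperm c b) : a = b := by
  unfold bperm at h; split_ifs at h <;> omega

lemma host_adj_s8 {q a b s t : ℕ} (hs : s < q) (ht : t < q)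
    (h : (a = 0 ∧ b = 0 ∧ s ≠ t) ∨ (a = 0 ∧ b = 1) ∨ (a = 1 ∧ b = 0) ∨ (a = 2 ∧ b = 2 ∧ s ≠ t) ∨
      (a = 2 ∧ b = 3) ∨ (a = 3 ∧ b = 2)) :
    (a*q+s < b*q+t ∧ bAdj q (a*q+s) (b*q+t)) ∨ (b*q+t < a*q+s ∧ bAdj q (b*q+t) (a*q+s)) := by
  unfold bAdj
  rcases h with ⟨rfl, rfl, h⟩ | ⟨rfl, rfl⟩ | ⟨rfl, rfl⟩ | ⟨rfl, rfl, h⟩ | ⟨rfl, rfl⟩ | ⟨rfl, rfl⟩ <;>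
  omega

lemma bperm_bcol (c a b : ℕ) (hc : c < 3) (hb : b < 4) (hab : a ≤ b) (h : bcol a b = c) :
    (bperm c a = 0 ∧ bperm c b = 0 ∧ a = b) ∨ (bperm c a = 0 ∧ bperm c b = 1) ∨
    (bperm c a = 1 ∧ bperm c b = 0) ∨ (bperm c a = 2 ∧ bperm c b = 2 ∧ a = b) ∨
      (bperm c a = 2 ∧ bperm c b = 3) ∨ (bperm c a = 3 ∧ bperm c b = 2) := by
  revert h
  interval_cases c <;> interval_cases b <;> interval_cases a <;> decide

lemma ppw_block {n q c : ℕ} (hq : 1 ≤ q) (hn : n ≤ 4*q) (hc : c < 3) (G : SimpleGraph (Fin n))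
    (h : ∀ u v : Fin n, u.1 < v.1 → G.Adj u v → bcol (u.1/q) (v.1/q) = c) :
    ppw n G ≤ q + 1 := by
  have hlt : ∀ u : Fin n, u.1/q < 4 := fun u => by
    rw [Nat.div_lt_iff_lt_mul (by omega)]; omega
  have hm : ∀ u : Fin n, u.1 % q < q := fun u => Nat.mod_lt _ (by omega)
  have hb : ∀ u : Fin n, bperm c (u.1/q) * q + u.1 % q < 4*q := fun u => by
    have h1 := bperm_lt c _ (hlt u)
    have h2 := hm u
    nlinarith
  refine ppw_le G _ (isLinear_host q hq) (fun u => ⟨bperm c (u.1/q) * q + u.1 % q, hb u⟩) ?_ ?_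
  · intro u v huv
    have e : bperm c (u.1/q) * q + u.1 % q = bperm c (v.1/q) * q + v.1 % q := congrArg Fin.val huv
    have e1 : u.1 % q = v.1 % q := by
      have := congrArg (· % q) e
      simpa using this
    have e2 : bperm c (u.1/q) = bperm c (v.1/q) := by
      rw [e1] at e
      exact Nat.eq_of_mul_eq_mul_right (by omega) (Nat.add_right_cancel e)
    have e3 := bperm_inj c _ _ (hlt u) (hlt v) e2
    apply Fin.ext
    rw [← Nat.div_add_mod u.1 q, ← Nat.div_add_mod v.1 q, e1, e3]
  · intro u v huv hA
    have hbc := bperm_bcol c _ _ hc (hlt v) (Nat.div_le_div_right huv.le) (h u v huv hA)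
    have hne : u.1/q = v.1/q → u.1 % q ≠ v.1 % q := fun e1 e2 => by
      have : u.1 = v.1 := by rw [← Nat.div_add_mod u.1 q, ← Nat.div_add_mod v.1 q, e1, e2]
      omega
    apply host_adj_s8 (hm u) (hm v)
    tauto

lemma ppw_edge {n m : ℕ} (G : SimpleGraph (Fin n))
    (h : ∀ u v : Fin n, u.1 < v.1 → G.Adj u v → u.1 = 0 ∧ v.1 = m) : ppw n G ≤ 1 := by
  by_cases hb : G = ⊥
  · simp [ppw, widthParam, hb]
  by_cases hm : 1 ≤ m ∧ m < n
  · obtain ⟨h1, h2⟩ := hm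
    refine ppw_le G _ (isLinear_path n (by omega))
      (Equiv.swap (⟨1, by omega⟩ : Fin n) ⟨m, h2⟩) (Equiv.injective _) ?_
    intro u v huv hA
    obtain ⟨hu, hv⟩ := h u v huv hA
    have hv' : v = ⟨m, h2⟩ := Fin.ext hv
    have hu' : u = ⟨0, by omega⟩ := Fin.ext hu
    rw [hv', Equiv.swap_apply_right, hu', Equiv.swap_apply_of_ne_of_ne]
    · exact Or.inl ⟨by simp, by simp⟩
    · simp
    · simp; omega
  · exfalso
    apply hb
    have key : ∀ u v : Fin n, u.1 < v.1 → ¬ G.Adj u v := fun u v huv hA => by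
      have := h u v huv hA
      have := v.2
      omega
    ext u v
    simp only [SimpleGraph.bot_adj, iff_false]
    intro hA
    rcases lt_trichotomy u.1 v.1 with h1 | h1 | h1
    · exact key u v h1 hA
    · exact hA.ne (Fin.ext h1)
    · exact key v u h1 hA.symm

/-- The colour classes. -/
def cG (n r : ℕ) (c : ℕ → ℕ → ℕ) (i : Fin r) : SimpleGraph (Fin n) :=
  bGraph n (fun x y => c x y = i.1)

lemma cG_adj {n r : ℕ} {c : ℕ → ℕ → ℕ} {i : Fin r} {u v : Fin n} (h : u.1 < v.1) :
    (cG n r c i).Adj u v ↔ c u.1 v.1 = i.1 := by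
  show (_ ∨ _) ↔ _
  constructor
  · rintro (h1 | h1)
    · exact h1.2
    · omega
  · intro h1; exact Or.inl ⟨h, h1⟩

lemma cG_decomp (n r : ℕ) (c : ℕ → ℕ → ℕ) (hc : ∀ x y, x < y → y < n → c x y < r) :
    IsDecomp (cG n r c) := by
  constructor
  · intro i j hij
    rw [disjoint_iff]
    ext u v
    simp only [SimpleGraph.inf_adj, SimpleGraph.bot_adj, iff_false]
    rintro ⟨h1, h2⟩
    apply hij
    apply Fin.ext
    rcases h1 with h1 | h1 <;> rcases h2 with h2 | h2 <;> omega
  · ext u v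
    simp only [SimpleGraph.iSup_adj, SimpleGraph.top_adj]
    constructor
    · rintro ⟨i, h⟩; exact h.ne
    · intro h
      have hne : u.1 ≠ v.1 := fun e => h (Fin.ext e)
      rcases Nat.lt_or_gt_of_ne hne with h1 | h1
      · exact ⟨⟨c u.1 v.1, hc _ _ h1 v.2⟩, Or.inl ⟨h1, rfl⟩⟩
      · exact ⟨⟨c v.1 u.1, hc _ _ h1 u.2⟩, Or.inr ⟨h1, rfl⟩⟩

lemma cG_sum (n r : ℕ) (hr : 3 ≤ r) (hn : 1 ≤ n) (c : ℕ → ℕ → ℕ)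
    (hc : ∀ x y, x < y → y < n → c x y = bcol (x/((n+3)/4)) (y/((n+3)/4)) ∨
      (3 ≤ c x y ∧ x = 0 ∧ c x y = y + 2)) :
    ∑ i, ppw n (cG n r c i) ≤ 3 * ((n + 3) / 4) + r := by
  obtain ⟨s, rfl⟩ := Nat.exists_eq_add_of_le hr
  have hb : ∀ a b, bcol a b < 3 := by intro a b; unfold bcol; split_ifs <;> omega
  rw [Fin.sum_univ_add]
  have h1 : ∑ i : Fin 3, ppw n (cG n (3+s) c (Fin.castAdd s i)) ≤ ∑ i : Fin 3, ((n+3)/4 + 1) := by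
    apply Finset.sum_le_sum
    intro i _
    apply ppw_block (c := i.1) (by omega) (by omega) i.2
    intro u v huv hA
    rw [cG_adj huv] at hA
    have := hc u.1 v.1 huv v.2
    have := i.2
    simp only [Fin.val_castAdd] at hA
    omega
  have h2 : ∑ i : Fin s, ppw n (cG n (3+s) c (Fin.natAdd 3 i)) ≤ ∑ i : Fin s, 1 := by
    apply Finset.sum_le_sum
    intro i _
    apply ppw_edge (m := i.1 + 1)
    intro u v huv hA
    rw [cG_adj huv] at hA
    have := hc u.1 v.1 huv v.2
    have := hb (u.1/((n+3)/4)) (v.1/((n+3)/4))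
    simp only [Fin.val_natAdd] at hA
    omega
  simp at h1 h2
  omega

end NG

theorem statement8 (r : ℕ) (hr : 3 ≤ r) :
    (∀ n : ℕ, 1 ≤ n → NG.NGsumLow (NG.ppw n) r ≤ 3 * ((n + 3) / 4) + r) ∧
    (∀ n : ℕ, 4 * r ≤ n →
      NG.NGsumLowND (NG.ppw n) r ≤ 3 * ((n + 3) / 4) + 2 * r - 3) := by
  have hb : ∀ a b, NG.bcol a b < 3 := by intro a b; unfold NG.bcol; split_ifs <;> omega
  constructor
  · intro n hn
    let c : ℕ → ℕ → ℕ := fun x y => NG.bcol (x/((n+3)/4)) (y/((n+3)/4))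
    refine le_trans (Nat.sInf_le ⟨NG.cG n r c, NG.cG_decomp n r c ?_, rfl⟩)
      (NG.cG_sum n r hr hn c ?_)
    · intro x y _ _
      exact lt_of_lt_of_le (hb _ _) hr
    · intro x y _ _; exact Or.inl rfl
  · intro n hn
    obtain ⟨q, hq⟩ : ∃ q, q = (n+3)/4 := ⟨_, rfl⟩
    let c : ℕ → ℕ → ℕ := fun x y => if x = 0 ∧ y + 2 < r then y + 2 else NG.bcol (x/q) (y/q)
    have hsum : ∑ i, NG.ppw n (NG.cG n r c i) ≤ 3 * ((n + 3) / 4) + r := by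
      refine NG.cG_sum n r hr (by omega) c ?_
      intro x y h1 h2
      simp only [c, ← hq]
      split_ifs with h
      · right; omega
      · left; rfl
    refine le_trans (Nat.sInf_le ⟨NG.cG n r c, ⟨NG.cG_decomp n r c ?_, ?_⟩, rfl⟩)
      (hsum.trans (by omega))
    · intro x y _ _
      simp only [c]
      have := hb (x/q) (y/q)
      split_ifs <;> omega
    · have key : ∀ (i : Fin r) (x y : ℕ), x < y → y < n → c x y = i.1 → NG.cG n r c i ≠ ⊥ := by
        intro i x y hxy hy h hbot
        have h1 : (NG.cG n r c i).Adj ⟨x, by omega⟩ ⟨y, hy⟩ := Or.inl ⟨hxy, h⟩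
        rw [hbot] at h1
        exact h1
      have hq0 : 0 < q := by omega
      have d1 : q / q = 1 := Nat.div_self hq0
      have d2 : 2*q / q = 2 := Nat.mul_div_cancel _ hq0
      intro i
      have hi := i.2
      by_cases h0 : i.1 = 0
      · refine key i 0 q (by omega) (by omega) ?_
        simp only [c]
        rw [if_neg (by omega), d1, h0, Nat.zero_div]; rfl
      by_cases h1 : i.1 = 1
      · refine key i 0 (2*q) (by omega) (by omega) ?_
        simp only [c]
        rw [if_neg (by omega), d2, h1, Nat.zero_div]; rfl
      by_cases h2 : i.1 = 2
      · refine key i q (2*q) (by omega) (by omega) ?_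
        simp only [c]
        rw [if_neg (by omega), d2, d1, h2]; rfl
      · refine key i 0 (i.1-2) (by omega) (by omega) ?_
        simp only [c]
        rw [if_pos ⟨trivial, by omega⟩]; omega
end

section
/- Let β ∈ {tw, la, pw, ppw} and fix an integer r ≥ 2. Then liminf_{n→∞} NGΣ↓_β(r;n)/n ≥ r − √(r² − r), and moreover r − √(r² − r) > 1/2. -/
open scoped Classical

namespace NG

lemma sum_min_le {n N : ℕ} (f : Fin n ↪ Fin N) (k : ℕ) (S : Finset (Fin n)) :
    ∑ v ∈ S, min k (S.filter (fun u => f u < f v)).card ≤ ∑ i ∈ Finset.range S.card, min k i := by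
  induction S using Finset.induction_on_max_value f with
  | empty => simp
  | insert a S ha hmax ih =>
    rw [Finset.sum_insert ha, Finset.card_insert_of_notMem ha, Finset.sum_range_succ, add_comm]
    refine Nat.add_le_add ?_ ?_
    · refine le_trans (le_of_eq ?_) ih
      refine Finset.sum_congr rfl fun v hv => ?_
      rw [Finset.filter_insert, if_neg (not_lt.mpr (hmax v hv))]
    · refine min_le_min le_rfl (Finset.card_le_card ?_)
      intro u hu
      simp only [Finset.mem_filter, Finset.mem_insert] at hu
      rcases hu with ⟨rfl | h, h2⟩
      · exact absurd h2 (lt_irrefl _)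
      · exact h

lemma sum_range_min (k n : ℕ) (h : k ≤ n) :
    2 * ∑ i ∈ Finset.range n, min k i + k * (k + 1) = 2 * k * n := by
  induction n, h using Nat.le_induction with
  | base =>
    have : ∑ i ∈ Finset.range k, min k i = ∑ i ∈ Finset.range k, i :=
      Finset.sum_congr rfl fun i hi => min_eq_right (Finset.mem_range.mp hi).le
    rw [this, mul_comm, Finset.sum_range_id_mul_two]
    cases k with
    | zero => rfl
    | succ m => simp; ring
  | succ n h ih =>
    rw [Finset.sum_range_succ, min_eq_left h]
    linarith

lemma back_le {k N : ℕ} {H : SimpleGraph (Fin N)} (h : IsKTreeOrd k N H) (j : Fin N) :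
    (backNbhd H j).card ≤ k := by
  by_cases hj : k < (j : ℕ)
  · exact (h.2.2.2 j hj).1.le
  · have : backNbhd H j ⊆ Finset.Iio j := by
      intro i hi
      simp only [backNbhd, Finset.mem_filter] at hi
      exact Finset.mem_Iio.mpr hi.2.1
    have := Finset.card_le_card this
    rw [Fin.card_Iio] at this
    omega

lemma count_le {n N k : ℕ} {H : SimpleGraph (Fin N)} {G : SimpleGraph (Fin n)}
    (f : Fin n ↪ Fin N) (h : IsKTreeOrd k N H)
    (hf : ∀ u v : Fin n, G.Adj u v → H.Adj (f u) (f v)) (hk : k ≤ n) :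
    (Finset.univ.filter (fun p : Fin n × Fin n => G.Adj p.1 p.2)).card + k * (k + 1)
      ≤ 2 * k * n := by
  have h1 : (Finset.univ.filter (fun p : Fin n × Fin n => G.Adj p.1 p.2)).card ≤
      2 * ∑ v, (Finset.univ.filter (fun u => f u < f v ∧ G.Adj u v)).card := by
    have e1 : ∑ v, (Finset.univ.filter (fun u => f u < f v ∧ G.Adj u v)).card =
        (Finset.univ.filter (fun p : Fin n × Fin n => f p.1 < f p.2 ∧ G.Adj p.1 p.2)).card := by
      simp only [Finset.card_filter, Fintype.sum_prod_type_right]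
    have e2 : (Finset.univ.filter (fun p : Fin n × Fin n => f p.2 < f p.1 ∧ G.Adj p.1 p.2)).card =
        (Finset.univ.filter (fun p : Fin n × Fin n => f p.1 < f p.2 ∧ G.Adj p.1 p.2)).card := by
      refine Finset.card_bij (fun p _ => p.swap) ?_ ?_ ?_
      · intro p hp
        simp only [Finset.mem_filter, Finset.mem_univ, true_and] at hp ⊢
        exact ⟨hp.1, hp.2.symm⟩
      · intro p _ q _ h
        exact Prod.swap_injective h
      · intro p hp
        simp only [Finset.mem_filter, Finset.mem_univ, true_and] at hp
        refine ⟨p.swap, ?_, by simp⟩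
        simp only [Finset.mem_filter, Finset.mem_univ, true_and]
        exact ⟨hp.1, hp.2.symm⟩
    rw [e1, two_mul]
    nth_rewrite 1 [← e2]
    refine le_trans (Finset.card_le_card ?_) (Finset.card_union_le _ _)
    intro p hp
    simp only [Finset.mem_filter, Finset.mem_univ, true_and, Finset.mem_union] at hp ⊢
    rcases lt_trichotomy (f p.1) (f p.2) with h | h | h
    · exact Or.inr ⟨h, hp⟩
    · exact absurd (f.injective h) hp.ne
    · exact Or.inl ⟨h, hp⟩
  have h2 : ∑ v, (Finset.univ.filter (fun u => f u < f v ∧ G.Adj u v)).card ≤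
      ∑ v, min k (Finset.univ.filter (fun u => f u < f v)).card := by
    refine Finset.sum_le_sum fun v _ => le_min ?_ ?_
    · refine le_trans ?_ (back_le h (f v))
      refine Finset.card_le_card_of_injOn f ?_ f.injective.injOn
      intro u hu
      simp only [Finset.coe_filter, Finset.mem_univ, true_and, Set.mem_ofPred_eq] at hu
      simp only [backNbhd, Finset.coe_filter, Finset.mem_univ, true_and, Set.mem_ofPred_eq]
      exact ⟨hu.1, hf _ _ hu.2⟩
    · refine Finset.card_le_card ?_
      intro u hu
      simp only [Finset.mem_filter, Finset.mem_univ, true_and] at hu ⊢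
      exact hu.1
  have h3 := sum_min_le f k Finset.univ
  rw [Finset.card_univ, Fintype.card_fin] at h3
  have h4 := sum_range_min k n hk
  omega

lemma width_bound (P : ℕ → (N : ℕ) → SimpleGraph (Fin N) → Prop)
    (hP1 : ∀ k N H, P k N H → IsKTreeOrd k N H)
    (hP2 : ∀ n, 1 ≤ n → P n (n + 1) ⊤) (n : ℕ) (G : SimpleGraph (Fin n)) :
    widthParam P n G ≤ n ∧
    (Finset.univ.filter (fun p : Fin n × Fin n => G.Adj p.1 p.2)).card +
      widthParam P n G * (widthParam P n G + 1) ≤ 2 * widthParam P n G * n := by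
  unfold widthParam
  split_ifs with hG
  · subst hG; simp
  · set A := {k | ∃ (N : ℕ) (H : SimpleGraph (Fin N)) (f : Fin n ↪ Fin N),
      P k N H ∧ ∀ u v : Fin n, G.Adj u v → H.Adj (f u) (f v)} with hA
    obtain ⟨m, rfl, hm⟩ : ∃ m, n = m + 1 ∧ 1 ≤ m := by
      rcases n with _ | _ | m
      · exact absurd (Subsingleton.elim _ _) hG
      · refine absurd ?_ hG
        ext u v
        have := u.2
        have := v.2
        have huv : u = v := Fin.ext (by omega)
        simp [huv]
      · exact ⟨m + 1, rfl, by omega⟩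
    have hmem : m ∈ A :=
      ⟨m + 1, ⊤, Function.Embedding.refl _, hP2 m hm, fun u v h => h.ne⟩
    have hle : sInf A ≤ m + 1 := (Nat.sInf_le hmem).trans (Nat.le_succ m)
    obtain ⟨N, H, f, h1, h2⟩ := Nat.sInf_mem ⟨m, hmem⟩
    exact ⟨hle, count_le f (hP1 _ _ _ h1) h2 hle⟩

lemma ktree_top (n : ℕ) (hn : 1 ≤ n) : IsKTreeOrd n (n + 1) ⊤ := by
  refine ⟨hn, le_rfl, ?_, ?_⟩
  · intro i j h _
    simp only [SimpleGraph.top_adj]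
    rintro rfl
    omega
  · intro j h
    have := j.2
    omega

lemma beta_bound (β : (n : ℕ) → SimpleGraph (Fin n) → ℕ)
    (hβ : β = NG.treewidth ∨ β = NG.la ∨ β = NG.pw ∨ β = NG.ppw)
    (n : ℕ) (G : SimpleGraph (Fin n)) :
    β n G ≤ n ∧
    (Finset.univ.filter (fun p : Fin n × Fin n => G.Adj p.1 p.2)).card +
      β n G * (β n G + 1) ≤ 2 * β n G * n := by
  rcases hβ with rfl | rfl | rfl | rfl
  · exact width_bound _ (fun _ _ _ h => h) ktree_top n G
  · refine width_bound _ (fun _ _ _ h => h.1) (fun n hn => ⟨ktree_top n hn, ?_⟩) n G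
    intro j h
    have := j.2
    omega
  · refine width_bound _ (fun _ _ _ h => h.1) (fun n hn => ⟨ktree_top n hn, ?_⟩) n G
    intro i j _ h
    have := j.2
    omega
  · refine width_bound _ (fun _ _ _ h => h.1) (fun n hn => ⟨ktree_top n hn, ?_⟩) n G
    intro i j _ h
    have := j.2
    omega

lemma decomp_bound (β : (n : ℕ) → SimpleGraph (Fin n) → ℕ)
    (hβ : β = NG.treewidth ∨ β = NG.la ∨ β = NG.pw ∨ β = NG.ppw)
    (n r : ℕ) (hr : 1 ≤ r) (G : Fin r → SimpleGraph (Fin n)) (hG : IsDecomp G) :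
    (n : ℝ) ^ 2 - n + (∑ i, (β n (G i) : ℝ)) ^ 2 / r ≤ 2 * n * ∑ i, (β n (G i) : ℝ) := by
  have h1 : n * n ≤ n +
      ∑ i, (Finset.univ.filter (fun p : Fin n × Fin n => (G i).Adj p.1 p.2)).card := by
    have hsub : (Finset.univ : Finset (Fin n × Fin n)) ⊆ Finset.univ.image (fun x : Fin n => (x, x)) ∪
        Finset.univ.biUnion
          (fun i => Finset.univ.filter (fun p : Fin n × Fin n => (G i).Adj p.1 p.2)) := by
      rintro ⟨u, v⟩ _
      simp only [Finset.mem_union, Finset.mem_image, Finset.mem_biUnion, Finset.mem_filter,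
        Finset.mem_univ, true_and]
      by_cases h : u = v
      · left; exact ⟨u, by rw [← h]⟩
      · right
        have : (⨆ i, G i).Adj u v := by rw [hG.2]; exact h
        exact SimpleGraph.iSup_adj.mp this
    have := (Finset.card_le_card hsub).trans (Finset.card_union_le _ _)
    have h2 := (Finset.card_image_le (s := Finset.univ) (f := fun x : Fin n => (x, x)))
    have h3 := Finset.card_biUnion_le (s := (Finset.univ : Finset (Fin r)))
      (t := fun i => Finset.univ.filter (fun p : Fin n × Fin n => (G i).Adj p.1 p.2))
    simp only [Finset.card_univ, Fintype.card_prod, Fintype.card_fin] at this h2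
    omega
  have h2 : ∑ i, ((Finset.univ.filter (fun p : Fin n × Fin n => (G i).Adj p.1 p.2)).card : ℝ)
      + ∑ i, (β n (G i) : ℝ) ^ 2 ≤ 2 * n * ∑ i, (β n (G i) : ℝ) := by
    rw [← Finset.sum_add_distrib, Finset.mul_sum]
    refine Finset.sum_le_sum fun i _ => ?_
    have := (beta_bound β hβ n (G i)).2
    have h : (((Finset.univ.filter (fun p : Fin n × Fin n => (G i).Adj p.1 p.2)).card +
      β n (G i) * (β n (G i) + 1) : ℕ) : ℝ) ≤ ((2 * β n (G i) * n : ℕ) : ℝ) := by exact_mod_cast this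
    push_cast at h
    have : (0:ℝ) ≤ β n (G i) := Nat.cast_nonneg _
    linarith
  have h3 : (∑ i, (β n (G i) : ℝ)) ^ 2 / r ≤ ∑ i, (β n (G i) : ℝ) ^ 2 := by
    have := sq_sum_le_card_mul_sum_sq (s := (Finset.univ : Finset (Fin r)))
      (f := fun i => (β n (G i) : ℝ))
    rw [Finset.card_univ, Fintype.card_fin] at this
    rw [div_le_iff₀' (by exact_mod_cast hr)]
    exact this
  have h4 : (n : ℝ) * n ≤ n +
      ∑ i, ((Finset.univ.filter (fun p : Fin n × Fin n => (G i).Adj p.1 p.2)).card : ℝ) := by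
    exact_mod_cast h1
  linarith

lemma exists_decomp (n r : ℕ) (hr : 1 ≤ r) :
    ∃ G : Fin r → SimpleGraph (Fin n), IsDecomp G := by
  refine ⟨fun i => if i = ⟨0, hr⟩ then ⊤ else ⊥, ?_, ?_⟩
  · intro i j hij
    by_cases h : i = ⟨0, hr⟩
    · have : j ≠ ⟨0, hr⟩ := fun h' => hij (h.trans h'.symm)
      simp [this]
    · simp [h]
  · refine top_le_iff.mp (le_trans ?_ (le_iSup _ (⟨0, hr⟩ : Fin r)))
    simp

lemma low_bounds (β : (n : ℕ) → SimpleGraph (Fin n) → ℕ)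
    (hβ : β = NG.treewidth ∨ β = NG.la ∨ β = NG.pw ∨ β = NG.ppw)
    (n r : ℕ) (hr : 1 ≤ r) :
    (NGsumLow (β n) r : ℝ) ≤ r * n ∧
    (n : ℝ) ^ 2 - n + (NGsumLow (β n) r : ℝ) ^ 2 / r ≤ 2 * n * (NGsumLow (β n) r : ℝ) := by
  obtain ⟨G0, hG0⟩ := exists_decomp n r hr
  obtain ⟨G, hG, hs⟩ := Nat.sInf_mem (s := {s | ∃ G : Fin r → SimpleGraph (Fin n),
    IsDecomp G ∧ ∑ i, β n (G i) = s}) ⟨_, G0, hG0, rfl⟩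
  change _ = NGsumLow (β n) r at hs
  have h := decomp_bound β hβ n r hr G hG
  have hle : ∑ i, β n (G i) ≤ r * n := by
    refine le_trans (Finset.sum_le_sum fun i _ => (beta_bound β hβ n (G i)).1) ?_
    simp
  rw [← hs]
  push_cast
  exact ⟨by exact_mod_cast hle, h⟩

end NG

/-- For `β ∈ {tw, la, pw, ppw}` and fixed `r ≥ 2`:
`liminf_{n→∞} NGΣ↓_β(r;n)/n ≥ r − √(r² − r) > 1/2`. -/
theorem statement10 (r : ℕ) (hr : 2 ≤ r)
    (β : (n : ℕ) → SimpleGraph (Fin n) → ℕ)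
    (hβ : β = NG.treewidth ∨ β = NG.la ∨ β = NG.pw ∨ β = NG.ppw) :
    ((r : ℝ) - Real.sqrt ((r : ℝ) ^ 2 - r) ≤
      Filter.liminf (fun n : ℕ => (NG.NGsumLow (β n) r : ℝ) / n) Filter.atTop) ∧
    (1 / 2 : ℝ) < (r : ℝ) - Real.sqrt ((r : ℝ) ^ 2 - r) := by
  have hr2 : (2 : ℝ) ≤ r := by exact_mod_cast hr
  constructor
  · have ht : Filter.Tendsto (fun n : ℕ => (r : ℝ) - Real.sqrt ((r : ℝ) ^ 2 - r + r * (1 / (n : ℝ))))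
        Filter.atTop (nhds ((r : ℝ) - Real.sqrt ((r : ℝ) ^ 2 - r))) := by
      have h0 := (tendsto_one_div_atTop_nhds_zero_nat (𝕜 := ℝ)).const_mul (r : ℝ)
      have h1 := (h0.const_add ((r : ℝ) ^ 2 - r)).sqrt.const_sub (r : ℝ)
      simpa using h1
    rw [← ht.liminf_eq]
    refine Filter.liminf_le_liminf ?_ ht.isBoundedUnder_ge ?_
    · filter_upwards [Filter.eventually_gt_atTop 0] with n hn
      obtain ⟨_, h2⟩ := NG.low_bounds β hβ n r (by omega)
      have hn' : (0 : ℝ) < n := by exact_mod_cast hn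
      set S : ℝ := (NG.NGsumLow (β n) r : ℝ)
      rw [sub_le_comm]
      refine Real.le_sqrt_of_sq_le ?_
      have hs : S = (S / n) * n := by field_simp
      set s := S / n
      rw [hs] at h2
      have h3 : (n : ℝ) ^ 2 * ((r - s) ^ 2) ≤ (n : ℝ) ^ 2 * ((r : ℝ) ^ 2 - r + r * (1 / (n : ℝ))) := by
        have h4 := mul_le_mul_of_nonneg_left h2 (by linarith : (0:ℝ) ≤ r)
        have e1 : (r : ℝ) * ((n : ℝ) ^ 2 - n + (s * n) ^ 2 / r) = r * n ^ 2 - r * n + (s * n) ^ 2 := by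
          field_simp
        have e2 : (n : ℝ) ^ 2 * ((r : ℝ) ^ 2 - r + r * (1 / (n : ℝ))) =
            n ^ 2 * r ^ 2 - n ^ 2 * r + r * n := by
          field_simp
        rw [e1] at h4
        rw [e2]
        nlinarith
      exact le_of_mul_le_mul_left h3 (by positivity)
    · refine Filter.IsBoundedUnder.isCoboundedUnder_ge ⟨(r : ℝ), ?_⟩
      rw [Filter.eventually_map]
      filter_upwards [Filter.eventually_gt_atTop 0] with n hn
      have hn' : (0 : ℝ) < n := by exact_mod_cast hn
      rw [div_le_iff₀ hn']
      exact (NG.low_bounds β hβ n r (by omega)).1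
  · have : Real.sqrt ((r : ℝ) ^ 2 - r) < r - 1 / 2 := by
      rw [Real.sqrt_lt' (by linarith)]
      nlinarith
    linarith
end
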